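/- arXiv:1512.01490 — 3 statements merged into one kernel-verified Lean document; each statement's English description precedes it below -/
import Mathlib

section
/- Let φ: [0, ∞) → [0, ∞) be an integrable log-concave function. Then p ↦ Γ(p)^{-1} ∫₀^∞ t^{p-1} φ(t) dt is log-concave on (0, ∞). -/
open MeasureTheory Real

/-- A nontrivial interval `J` of the real line can be cut out by an inequality
`c * exp (-(u * s)) + d * exp (v * s) ≤ 1`, up to the endpoints, where equality holds. -/
lemma exists_exp_combination_le_one_iff {u v : ℝ} (hu : 0 < u) (hv : 0 < v) {J : Set ℝ}
    (hJ : J.OrdConnected) (hJn : J.Nontrivial) :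
    ∃ c d : ℝ, ∀ s, (s ∈ J → c * exp (-(u * s)) + d * exp (v * s) ≤ 1) ∧
      (s ∉ J → 1 ≤ c * exp (-(u * s)) + d * exp (v * s)) := by
  have hne := hJn.nonempty
  by_cases hb : BddBelow J <;> by_cases ha : BddAbove J
  · obtain ⟨x, hx, y, hy, hxy⟩ := hJn.exists_lt
    have hlt : sInf J < sSup J := (csInf_le hb hx).trans_lt (hxy.trans_le (le_csSup ha hy))
    have hsub : ∀ s ∈ J, s ∈ Set.Icc (sInf J) (sSup J) :=
      fun s hs => ⟨csInf_le hb hs, le_csSup ha hs⟩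
    have hout : ∀ s ∉ J, s ≤ sInf J ∨ sSup J ≤ s := by
      intro s hs
      by_contra! h
      obtain ⟨x, hx, hxs⟩ := exists_lt_of_csInf_lt hne h.1
      obtain ⟨y, hy, hys⟩ := exists_lt_of_lt_csSup hne h.2
      exact hs (hJ.out hx hy ⟨hxs.le, hys.le⟩)
    generalize sInf J = α at *
    generalize sSup J = β at *
    have hP : exp (-(u * β)) < exp (-(u * α)) := exp_lt_exp.2 (by nlinarith)
    have hQ : exp (v * α) < exp (v * β) := exp_lt_exp.2 (by nlinarith)
    have hdet : 0 < exp (-(u * α)) * exp (v * β) - exp (-(u * β)) * exp (v * α) := by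
      have := mul_lt_mul'' hP hQ (exp_pos _).le (exp_pos _).le
      linarith
    obtain ⟨c, d, hc, hd, hα, hβ⟩ : ∃ c d : ℝ, 0 ≤ c ∧ 0 ≤ d ∧
        c * exp (-(u * α)) + d * exp (v * α) = 1 ∧
        c * exp (-(u * β)) + d * exp (v * β) = 1 := by
      refine ⟨(exp (v * β) - exp (v * α)) /
          (exp (-(u * α)) * exp (v * β) - exp (-(u * β)) * exp (v * α)),
        (exp (-(u * α)) - exp (-(u * β))) /
          (exp (-(u * α)) * exp (v * β) - exp (-(u * β)) * exp (v * α)),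
        div_nonneg (by linarith) hdet.le, div_nonneg (by linarith) hdet.le, ?_, ?_⟩ <;>
      · rw [div_mul_eq_mul_div, div_mul_eq_mul_div, ← add_div, div_eq_one_iff_eq hdet.ne']
        ring
    have hconv : ConvexOn ℝ Set.univ (fun s => c * exp (-(u * s)) + d * exp (v * s)) := by
      have h1 : ConvexOn ℝ Set.univ (fun s => exp (-(u * s))) := by
        have := convexOn_exp.comp_linearMap (LinearMap.mul ℝ ℝ (-u))
        simpa [Function.comp_def] using this
      have h2 : ConvexOn ℝ Set.univ (fun s => exp (v * s)) := by
        have := convexOn_exp.comp_linearMap (LinearMap.mul ℝ ℝ v)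
        simpa [Function.comp_def] using this
      exact (h1.smul hc).add (h2.smul hd)
    refine ⟨c, d, fun s => ⟨fun hs => ?_, fun hs => ?_⟩⟩
    · have hseg : s ∈ segment ℝ α β := by
        rw [segment_eq_Icc hlt.le]; exact hsub s hs
      have := hconv.le_on_segment (Set.mem_univ α) (Set.mem_univ β) hseg
      simpa [hα, hβ] using this
    · rcases hout s hs with h | h
      · rcases h.eq_or_lt with rfl | h
        · exact hα.ge
        · have hseg : α ∈ openSegment ℝ s β := by
            rw [openSegment_eq_Ioo (h.trans hlt)]; exact ⟨h, hlt⟩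
          have := hconv.le_left_of_right_le (Set.mem_univ s) (Set.mem_univ β) hseg
            (hβ.trans hα.symm).le
          exact hα.ge.trans this
      · rcases h.eq_or_lt with rfl | h
        · exact hβ.ge
        · have hseg : β ∈ openSegment ℝ α s := by
            rw [openSegment_eq_Ioo (hlt.trans h)]; exact ⟨hlt, h⟩
          have := hconv.le_right_of_left_le (Set.mem_univ α) (Set.mem_univ s) hseg
            (hα.trans hβ.symm).le
          exact hβ.ge.trans this
  · refine ⟨exp (u * sInf J), 0, fun s => ?_⟩
    rw [zero_mul, add_zero, ← exp_add, exp_le_one_iff, one_le_exp_iff]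
    refine ⟨fun hs => by nlinarith [csInf_le hb hs], fun hs => ?_⟩
    suffices s ≤ sInf J by nlinarith
    by_contra! h
    obtain ⟨x, hx, hxs⟩ := exists_lt_of_csInf_lt hne h
    obtain ⟨y, hy, hys⟩ := not_bddAbove_iff.1 ha s
    exact hs (hJ.out hx hy ⟨hxs.le, hys.le⟩)
  · refine ⟨0, exp (-(v * sSup J)), fun s => ?_⟩
    rw [zero_mul, zero_add, ← exp_add, exp_le_one_iff, one_le_exp_iff]
    refine ⟨fun hs => by nlinarith [le_csSup ha hs], fun hs => ?_⟩
    suffices sSup J ≤ s by nlinarith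
    by_contra! h
    obtain ⟨x, hx, hxs⟩ := exists_lt_of_lt_csSup hne h
    obtain ⟨y, hy, hys⟩ := not_bddBelow_iff.1 hb s
    exact hs (hJ.out hy hx ⟨hys.le, hxs.le⟩)
  · refine ⟨0, 0, fun s => ⟨fun _ => by simp, fun hs => ?_⟩⟩
    obtain ⟨x, hx, hxs⟩ := not_bddAbove_iff.1 ha s
    obtain ⟨y, hy, hys⟩ := not_bddBelow_iff.1 hb s
    exact (hs (hJ.out hy hx ⟨hys.le, hxs.le⟩)).elim

/-- For `p < r < q` and an interval `I` of positive reals, some combination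
`t ^ r - c * t ^ p - d * t ^ q` is nonnegative on `I` and nonpositive off `I`, almost everywhere. -/
lemma exists_rpow_combination_sign {p q r : ℝ} (hpr : p < r) (hrq : r < q) {I : Set ℝ}
    (hI : I.OrdConnected) (hI0 : I ⊆ Set.Ioi 0) :
    ∃ c d : ℝ, ∀ᵐ t ∂volume.restrict (Set.Ioi (0 : ℝ)),
      (t ∈ I → 0 ≤ t ^ r - c * t ^ p - d * t ^ q) ∧
      (t ∉ I → t ^ r - c * t ^ p - d * t ^ q ≤ 0) := by
  have key : ∀ c d t : ℝ, 0 < t → t ^ r - c * t ^ p - d * t ^ q =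
      t ^ r * (1 - (c * exp (-((r - p) * log t)) + d * exp ((q - r) * log t))) := by
    intro c d t ht
    simp only [rpow_def_of_pos ht]
    have h1 : exp (log t * p) = exp (log t * r) * exp (-((r - p) * log t)) := by
      rw [← exp_add]; ring_nf
    have h2 : exp (log t * q) = exp (log t * r) * exp ((q - r) * log t) := by
      rw [← exp_add]; ring_nf
    rw [h1, h2]; ring
  rcases I.subsingleton_or_nontrivial with hs | hn
  · refine ⟨1, 1, ?_⟩
    have hnull : ∀ᵐ t ∂volume.restrict (Set.Ioi (0 : ℝ)), t ∉ I :=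
      ae_restrict_of_ae (measure_eq_zero_iff_ae_notMem.1 (hs.measure_zero volume))
    filter_upwards [hnull, ae_restrict_mem measurableSet_Ioi] with t ht ht0
    refine ⟨fun h => (ht h).elim, fun _ => ?_⟩
    rw [key 1 1 t ht0]
    refine mul_nonpos_of_nonneg_of_nonpos (rpow_nonneg (le_of_lt ht0) _) ?_
    rcases le_total (log t) 0 with hl | hl
    · have : 1 ≤ exp (-((r - p) * log t)) := one_le_exp (by nlinarith)
      linarith [exp_pos ((q - r) * log t)]
    · have : 1 ≤ exp ((q - r) * log t) := one_le_exp (by nlinarith)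
      linarith [exp_pos (-((r - p) * log t))]
  · have hJ : (exp ⁻¹' I).OrdConnected := hI.preimage_mono exp_monotone
    have hJn : (exp ⁻¹' I).Nontrivial := by
      obtain ⟨x, hx, y, hy, hxy⟩ := hn
      refine ⟨log x, by simpa [exp_log (hI0 hx)] using hx,
        log y, by simpa [exp_log (hI0 hy)] using hy, fun h => hxy ?_⟩
      rw [← exp_log (hI0 hx), h, exp_log (hI0 hy)]
    obtain ⟨c, d, h⟩ := exists_exp_combination_le_one_iff (sub_pos.2 hpr) (sub_pos.2 hrq) hJ hJn
    refine ⟨c, d, ?_⟩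
    filter_upwards [ae_restrict_mem measurableSet_Ioi] with t ht0
    have ht := h (log t)
    rw [Set.mem_preimage, exp_log ht0] at ht
    rw [key c d t ht0]
    have hpos : 0 ≤ t ^ r := rpow_nonneg (le_of_lt ht0) _
    exact ⟨fun hI => mul_nonneg hpos (by linarith [ht.1 hI]),
      fun hI => mul_nonpos_of_nonneg_of_nonpos hpos (by linarith [ht.2 hI])⟩

section LogConcave

variable {φ : ℝ → ℝ}

lemma logConcave_mul_exp
    (hφ_lc : ∀ x ∈ Set.Ici (0 : ℝ), ∀ y ∈ Set.Ici (0 : ℝ), ∀ lam ∈ Set.Icc (0 : ℝ) 1,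
      φ x ^ (1 - lam) * φ y ^ lam ≤ φ ((1 - lam) * x + lam * y))
    (hφ_nonneg : ∀ t, 0 ≤ φ t) (k : ℝ) :
    ∀ x ∈ Set.Ici (0 : ℝ), ∀ y ∈ Set.Ici (0 : ℝ), ∀ lam ∈ Set.Icc (0 : ℝ) 1,
      (φ x * exp (k * x)) ^ (1 - lam) * (φ y * exp (k * y)) ^ lam ≤
        φ ((1 - lam) * x + lam * y) * exp (k * ((1 - lam) * x + lam * y)) := by
  intro x hx y hy l hl
  rw [mul_rpow (hφ_nonneg x) (exp_pos _).le, mul_rpow (hφ_nonneg y) (exp_pos _).le,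
    ← exp_mul, ← exp_mul]
  have h : exp (k * ((1 - l) * x + l * y)) = exp (k * x * (1 - l)) * exp (k * y * l) := by
    rw [← exp_add]; ring_nf
  rw [h, mul_mul_mul_comm]
  exact mul_le_mul_of_nonneg_right (hφ_lc x hx y hy l hl) (by positivity)

/-- If a log-concave function does not increase from `x` to a point `z` strictly between `x` and
`y`, then its value at `y` is at most its value at `x`. -/
lemma logConcave_le_of_le
    (hφ_lc : ∀ x ∈ Set.Ici (0 : ℝ), ∀ y ∈ Set.Ici (0 : ℝ), ∀ lam ∈ Set.Icc (0 : ℝ) 1,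
      φ x ^ (1 - lam) * φ y ^ lam ≤ φ ((1 - lam) * x + lam * y))
    (hφ_nonneg : ∀ t, 0 ≤ φ t) {x y z : ℝ} (hx : 0 ≤ x) (hy : 0 ≤ y)
    (hz : z ∈ openSegment ℝ x y) (hpos : 0 < φ x) (hzx : φ z ≤ φ x) : φ y ≤ φ x := by
  obtain ⟨a, b, ha, hb, hab, rfl⟩ := hz
  obtain rfl : a = 1 - b := by linarith
  have h := (hφ_lc x hx y hy b ⟨hb.le, by linarith⟩).trans hzx
  have h1 : φ x = φ x ^ (1 - b) * φ x ^ b := by rw [← rpow_add hpos]; simp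
  have h2 := le_of_mul_le_mul_left (h.trans_eq h1) (rpow_pos_of_pos hpos _)
  exact (rpow_le_rpow_iff (hφ_nonneg y) hpos.le hb).1 h2

lemma exists_lt_pos_of_not_ae_eq_zero (hφ_nonneg : ∀ t, 0 ≤ φ t)
    (hne : ¬ φ =ᵐ[volume.restrict (Set.Ioi (0 : ℝ))] 0) :
    ∃ x y, 0 < x ∧ x < y ∧ 0 < φ x ∧ 0 < φ y := by
  by_contra! h
  apply hne
  have hs : ({t : ℝ | 0 < t ∧ 0 < φ t}).Subsingleton := by
    intro x hx y hy
    by_contra hxy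
    rcases lt_or_gt_of_ne hxy with hlt | hlt
    · exact (h x y hx.1 hlt hx.2).not_gt hy.2
    · exact (h y x hy.1 hlt hy.2).not_gt hx.2
  have hnull := ae_restrict_of_ae (s := Set.Ioi (0 : ℝ))
    (measure_eq_zero_iff_ae_notMem.1 (hs.measure_zero volume))
  filter_upwards [hnull, ae_restrict_mem measurableSet_Ioi] with t ht ht0
  exact le_antisymm (not_lt.1 fun hp => ht ⟨ht0, hp⟩) (hφ_nonneg t)

lemma integrableOn_rpow_mul_exp {p b : ℝ} (hp : 0 < p) (hb : 0 < b) :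
    IntegrableOn (fun t : ℝ => t ^ (p - 1) * exp (-(b * t))) (Set.Ioi 0) := by
  have := integrableOn_rpow_mul_exp_neg_mul_rpow (s := p - 1) (p := 1) (by linarith) one_pos hb
  simpa using this

lemma logConcave_integrableOn_rpow_mul
    (hφ_nonneg : ∀ t, 0 ≤ φ t) (hφ_int : IntegrableOn φ (Set.Ioi (0 : ℝ)))
    (hφ_lc : ∀ x ∈ Set.Ici (0 : ℝ), ∀ y ∈ Set.Ici (0 : ℝ), ∀ lam ∈ Set.Icc (0 : ℝ) 1,
      φ x ^ (1 - lam) * φ y ^ lam ≤ φ ((1 - lam) * x + lam * y))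
    (hne : ¬ φ =ᵐ[volume.restrict (Set.Ioi (0 : ℝ))] 0) {p : ℝ} (hp : 0 < p) :
    IntegrableOn (fun t => t ^ (p - 1) * φ t) (Set.Ioi 0) := by
  obtain ⟨x, y, hx, hxy, hφx, hφy⟩ := exists_lt_pos_of_not_ae_eq_zero hφ_nonneg hne
  have hy := hx.trans hxy
  obtain ⟨z, hyz, hz⟩ : ∃ z, y < z ∧ φ z < φ y := by
    by_contra! h
    have hint : IntegrableOn (fun _ : ℝ => φ y) (Set.Ioi y) := by
      refine Integrable.mono' (hφ_int.mono_set (Set.Ioi_subset_Ioi hy.le))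
        aestronglyMeasurable_const ?_
      filter_upwards [ae_restrict_mem measurableSet_Ioi] with t ht
      rw [norm_of_nonneg hφy.le]
      exact h t ht
    rw [integrableOn_const_iff] at hint
    simp [hφy.ne'] at hint
  have hmeas : AEStronglyMeasurable (fun t => t ^ (p - 1) * φ t)
      (volume.restrict (Set.Ioi (0 : ℝ))) := by
    refine AEStronglyMeasurable.mul ?_ hφ_int.aestronglyMeasurable
    exact (measurable_id.pow_const (p - 1)).aestronglyMeasurable
  have hleft : IntegrableOn (fun t => t ^ (p - 1) * φ t) (Set.Ioo 0 x) := by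
    obtain ⟨k, hk0, hk⟩ : ∃ k : ℝ, 0 ≤ k ∧ φ x * exp (k * x) ≤ φ y * exp (k * y) := by
      refine ⟨max 0 ((log (φ x) - log (φ y)) / (y - x)), le_max_left _ _, ?_⟩
      have h := le_max_right 0 ((log (φ x) - log (φ y)) / (y - x))
      rw [div_le_iff₀ (sub_pos.2 hxy)] at h
      rw [← exp_log hφx, ← exp_log hφy, ← exp_add, ← exp_add, exp_le_exp, log_exp, log_exp]
      linarith
    have hpow : IntegrableOn (fun t : ℝ => t ^ (p - 1)) (Set.Ioo 0 x) :=
      (intervalIntegral.integrableOn_Ioo_rpow_iff hx).2 (by linarith)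
    refine Integrable.mono' (hpow.mul_const (φ y * exp (k * y)))
      (hmeas.mono_set Set.Ioo_subset_Ioi_self) ?_
    filter_upwards [ae_restrict_mem measurableSet_Ioo] with t ht
    have hpw : 0 ≤ t ^ (p - 1) := rpow_nonneg ht.1.le _
    rw [norm_of_nonneg (mul_nonneg hpw (hφ_nonneg t))]
    refine mul_le_mul_of_nonneg_left ?_ hpw
    have hseg : x ∈ openSegment ℝ y t := by
      rw [openSegment_symm, openSegment_eq_Ioo (ht.2.trans hxy)]; exact ⟨ht.2, hxy⟩
    have h := logConcave_le_of_le (φ := fun t => φ t * exp (k * t))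
      (logConcave_mul_exp hφ_lc hφ_nonneg k)
      (fun t => mul_nonneg (hφ_nonneg t) (exp_pos _).le) hy.le ht.1.le hseg
      (mul_pos hφy (exp_pos _)) hk
    exact (le_mul_of_one_le_right (hφ_nonneg t) (one_le_exp (mul_nonneg hk0 ht.1.le))).trans h
  have hmid : IntegrableOn (fun t => t ^ (p - 1) * φ t) (Set.Icc x z) := by
    refine IntegrableOn.continuousOn_mul ?_
      (hφ_int.mono_set fun t ht => hx.trans_le ht.1) isCompact_Icc
    exact fun t ht => (continuousAt_rpow_const t _ (.inl (hx.trans_le ht.1).ne')).continuousWithinAt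
  have hright : IntegrableOn (fun t => t ^ (p - 1) * φ t) (Set.Ioi z) := by
    obtain ⟨k, hk0, hk⟩ : ∃ k : ℝ, 0 < k ∧ φ z * exp (k * z) ≤ φ y * exp (k * y) := by
      obtain ⟨m, hm, hmy⟩ := exists_between (max_lt hz hφy)
      obtain ⟨hzm, hm0⟩ := max_lt_iff.1 hm
      refine ⟨(log (φ y) - log m) / (z - y),
        div_pos (sub_pos.2 (log_lt_log hm0 hmy)) (sub_pos.2 hyz), ?_⟩
      refine (mul_le_mul_of_nonneg_right hzm.le (exp_pos _).le).trans ?_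
      have h := div_mul_cancel₀ (log (φ y) - log m) (sub_pos.2 hyz).ne'
      rw [← exp_log hφy, ← exp_log hm0, ← exp_add, ← exp_add, exp_le_exp, log_exp, log_exp]
      linarith
    refine Integrable.mono' (((integrableOn_rpow_mul_exp hp hk0).mono_set
      (Set.Ioi_subset_Ioi (hy.trans hyz).le)).mul_const (φ y * exp (k * y)))
      (hmeas.mono_set (Set.Ioi_subset_Ioi (hy.trans hyz).le)) ?_
    filter_upwards [ae_restrict_mem measurableSet_Ioi] with t ht
    have ht0 : 0 < t := (hy.trans hyz).trans ht
    have hpw : 0 ≤ t ^ (p - 1) := rpow_nonneg ht0.le _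
    rw [norm_of_nonneg (mul_nonneg hpw (hφ_nonneg t)), mul_assoc]
    refine mul_le_mul_of_nonneg_left ?_ hpw
    have hseg : z ∈ openSegment ℝ y t := by
      rw [openSegment_eq_Ioo (hyz.trans ht)]; exact ⟨hyz, ht⟩
    have h := logConcave_le_of_le (φ := fun t => φ t * exp (k * t))
      (logConcave_mul_exp hφ_lc hφ_nonneg k)
      (fun t => mul_nonneg (hφ_nonneg t) (exp_pos _).le) hy.le ht0.le hseg
      (mul_pos hφy (exp_pos _)) hk
    rw [exp_neg, inv_mul_eq_div, le_div_iff₀ (exp_pos _)]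
    exact h
  refine ((hleft.union hmid).union hright).mono_set fun t ht => ?_
  rcases lt_or_ge t x with h | h
  · exact .inl (.inl ⟨ht, h⟩)
  · rcases le_or_gt t z with h' | h'
    · exact .inl (.inr ⟨h, h'⟩)
    · exact .inr h'

/-- If a log-concave function and an exponential have equal moments of orders `p` and `q`, then
the moments of intermediate order of the exponential are at most those of the function. -/
lemma logConcave_moment_ge_exp
    (hφ_nonneg : ∀ t, 0 ≤ φ t)
    (hφ_lc : ∀ x ∈ Set.Ici (0 : ℝ), ∀ y ∈ Set.Ici (0 : ℝ), ∀ lam ∈ Set.Icc (0 : ℝ) 1,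
      φ x ^ (1 - lam) * φ y ^ lam ≤ φ ((1 - lam) * x + lam * y))
    (hint : ∀ p : ℝ, 0 < p → IntegrableOn (fun t => t ^ (p - 1) * φ t) (Set.Ioi 0))
    {p q r a b : ℝ} (hp : 0 < p) (hpr : p < r) (hrq : r < q) (ha : 0 < a) (hb : 0 < b)
    (hmp : ∫ t in Set.Ioi (0 : ℝ), t ^ (p - 1) * φ t =
      ∫ t in Set.Ioi (0 : ℝ), t ^ (p - 1) * (a * exp (-(b * t))))
    (hmq : ∫ t in Set.Ioi (0 : ℝ), t ^ (q - 1) * φ t =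
      ∫ t in Set.Ioi (0 : ℝ), t ^ (q - 1) * (a * exp (-(b * t)))) :
    ∫ t in Set.Ioi (0 : ℝ), t ^ (r - 1) * (a * exp (-(b * t))) ≤
      ∫ t in Set.Ioi (0 : ℝ), t ^ (r - 1) * φ t := by
  have hψ : ∀ p : ℝ, 0 < p →
      IntegrableOn (fun t => t ^ (p - 1) * (a * exp (-(b * t)))) (Set.Ioi 0) := by
    intro p hp
    refine IntegrableOn.congr_fun ((integrableOn_rpow_mul_exp hp hb).const_mul a)
      (fun t _ => ?_) measurableSet_Ioi
    ring
  have hI : ({t : ℝ | 0 < t ∧ a * exp (-(b * t)) ≤ φ t}).OrdConnected := by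
    refine Convex.ordConnected ?_
    rintro x ⟨hx, hxφ⟩ y ⟨hy, hyφ⟩ α β hα hβ hαβ
    obtain rfl : α = 1 - β := by linarith
    refine ⟨(convex_Ioi (0 : ℝ)) hx hy hα hβ hαβ, ?_⟩
    have hle := hφ_lc x hx.le y hy.le β ⟨hβ, by linarith⟩
    refine le_trans ?_ hle
    refine le_trans (le_of_eq ?_) (mul_le_mul (rpow_le_rpow (by positivity) hxφ hα)
      (rpow_le_rpow (by positivity) hyφ hβ) (by positivity) (rpow_nonneg (hφ_nonneg x) _))
    rw [← exp_log ha, ← exp_add, ← exp_add, ← exp_add, ← exp_mul, ← exp_mul, ← exp_add]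
    simp only [smul_eq_mul]
    ring_nf
  obtain ⟨c, d, hcd⟩ := exists_rpow_combination_sign (p := p - 1) (q := q - 1) (r := r - 1)
    (by linarith) (by linarith) hI (fun t ht => ht.1)
  have hr := hp.trans hpr
  have hq := hr.trans hrq
  have hD : ∀ p : ℝ, 0 < p → IntegrableOn
      (fun t => t ^ (p - 1) * φ t - t ^ (p - 1) * (a * exp (-(b * t)))) (Set.Ioi 0) :=
    fun p hp => (hint p hp).sub (hψ p hp)
  have hnonneg : 0 ≤ ∫ t in Set.Ioi (0 : ℝ),
      ((t ^ (r - 1) * φ t - t ^ (r - 1) * (a * exp (-(b * t)))) -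
        c * (t ^ (p - 1) * φ t - t ^ (p - 1) * (a * exp (-(b * t)))) -
        d * (t ^ (q - 1) * φ t - t ^ (q - 1) * (a * exp (-(b * t))))) := by
    refine integral_nonneg_of_ae ?_
    filter_upwards [hcd, ae_restrict_mem measurableSet_Ioi] with t ht ht0
    have hfac : 0 ≤ (t ^ (r - 1) - c * t ^ (p - 1) - d * t ^ (q - 1)) *
        (φ t - a * exp (-(b * t))) := by
      by_cases hmem : a * exp (-(b * t)) ≤ φ t
      · exact mul_nonneg (ht.1 ⟨ht0, hmem⟩) (sub_nonneg.2 hmem)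
      · exact mul_nonneg_of_nonpos_of_nonpos (ht.2 fun h => hmem h.2)
          (sub_nonpos.2 (not_le.1 hmem).le)
    refine hfac.trans_eq ?_
    ring
  have hDrp : IntegrableOn
      (fun t => t ^ (r - 1) * φ t - t ^ (r - 1) * (a * exp (-(b * t))) -
        c * (t ^ (p - 1) * φ t - t ^ (p - 1) * (a * exp (-(b * t))))) (Set.Ioi 0) :=
    (hD r hr).sub ((hD p hp).const_mul c)
  rw [integral_sub hDrp ((hD q hq).const_mul d),
    integral_sub (hD r hr) ((hD p hp).const_mul c), integral_const_mul, integral_const_mul,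
    integral_sub (hint r hr) (hψ r hr), integral_sub (hint p hp) (hψ p hp),
    integral_sub (hint q hq) (hψ q hq), hmp, hmq] at hnonneg
  linarith

end LogConcave

lemma integral_rpow_mul_exp_exp {p : ℝ} (hp : 0 < p) (A B : ℝ) :
    ∫ t in Set.Ioi (0 : ℝ), t ^ (p - 1) * (exp A * exp (-(exp B * t))) =
      Gamma p * exp (A - p * B) := by
  have h := integral_rpow_mul_exp_neg_mul_Ioi hp (exp_pos B)
  have h2 : ∀ t : ℝ, t ^ (p - 1) * (exp A * exp (-(exp B * t))) =
      exp A * (t ^ (p - 1) * exp (-(exp B * t))) := fun t => by ring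
  simp only [h2]
  rw [integral_const_mul, h, one_div, ← exp_neg, ← exp_mul, sub_eq_add_neg, exp_add]
  ring_nf

/-- For `φ : [0,∞) → [0,∞)` integrable and log-concave,
`p ↦ Γ(p)⁻¹ ∫₀^∞ t^{p-1} φ(t) dt` is log-concave on `(0,∞)`. -/
theorem stmt5
    (φ : ℝ → ℝ)
    (hφ_nonneg : ∀ t, 0 ≤ φ t)
    (hφ_int : IntegrableOn φ (Set.Ioi (0 : ℝ)))
    (hφ_lc : ∀ x ∈ Set.Ici (0 : ℝ), ∀ y ∈ Set.Ici (0 : ℝ), ∀ lam ∈ Set.Icc (0 : ℝ) 1,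
      φ x ^ (1 - lam) * φ y ^ lam ≤ φ ((1 - lam) * x + lam * y)) :
    ConcaveOn ℝ (Set.Ioi (0 : ℝ))
      (fun p => Real.log ((Real.Gamma p)⁻¹ * ∫ t in Set.Ioi (0 : ℝ), t ^ (p - 1) * φ t)) := by
  by_cases hne : φ =ᵐ[volume.restrict (Set.Ioi (0 : ℝ))] 0
  · have hzero : ∀ p : ℝ, ∫ t in Set.Ioi (0 : ℝ), t ^ (p - 1) * φ t = 0 := by
      intro p
      refine integral_eq_zero_of_ae ?_
      filter_upwards [hne] with t ht
      simp [ht]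
    simp only [hzero, mul_zero, log_zero]
    exact concaveOn_const 0 (convex_Ioi 0)
  have hint : ∀ p : ℝ, 0 < p → IntegrableOn (fun t => t ^ (p - 1) * φ t) (Set.Ioi 0) :=
    fun p hp => logConcave_integrableOn_rpow_mul hφ_nonneg hφ_int hφ_lc hne hp
  have hpos : ∀ p : ℝ, 0 < p → 0 < (Gamma p)⁻¹ * ∫ t in Set.Ioi (0 : ℝ), t ^ (p - 1) * φ t := by
    intro p hp
    have h0 : 0 ≤ᵐ[volume.restrict (Set.Ioi (0 : ℝ))] fun t => t ^ (p - 1) * φ t := by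
      filter_upwards [ae_restrict_mem measurableSet_Ioi] with t ht
      exact mul_nonneg (rpow_nonneg (le_of_lt ht) _) (hφ_nonneg t)
    refine mul_pos (inv_pos.2 (Gamma_pos_of_pos hp))
      ((integral_nonneg_of_ae h0).lt_of_ne' fun h => hne ?_)
    filter_upwards [(integral_eq_zero_iff_of_nonneg_ae h0 (hint p hp)).1 h,
      ae_restrict_mem measurableSet_Ioi] with t ht ht0
    exact (mul_eq_zero.1 ht).resolve_left (rpow_pos_of_pos ht0 _).ne'
  refine LinearOrder.concaveOn_of_lt (convex_Ioi 0) ?_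
  intro p hp q hq hpq α β hα hβ hαβ
  have hp : 0 < p := hp
  have hq : 0 < q := hq
  obtain rfl : α = 1 - β := by linarith
  simp only [smul_eq_mul]
  set r := (1 - β) * p + β * q with hr
  have hpr : p < r := by nlinarith
  have hrq : r < q := by nlinarith
  have hr0 := hp.trans hpr
  have hmoment : ∀ s A B : ℝ, 0 < s →
      log ((Gamma s)⁻¹ * ∫ t in Set.Ioi (0 : ℝ), t ^ (s - 1) * φ t) = A - s * B →
      ∫ t in Set.Ioi (0 : ℝ), t ^ (s - 1) * φ t =
        ∫ t in Set.Ioi (0 : ℝ), t ^ (s - 1) * (exp A * exp (-(exp B * t))) := by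
    intro s A B hs h
    rw [integral_rpow_mul_exp_exp hs, ← h, exp_log (hpos s hs),
      mul_inv_cancel_left₀ (Gamma_pos_of_pos hs).ne']
  obtain ⟨A, B, hAp, hAq⟩ : ∃ A B : ℝ,
      log ((Gamma p)⁻¹ * ∫ t in Set.Ioi (0 : ℝ), t ^ (p - 1) * φ t) = A - p * B ∧
      log ((Gamma q)⁻¹ * ∫ t in Set.Ioi (0 : ℝ), t ^ (q - 1) * φ t) = A - q * B := by
    generalize log ((Gamma p)⁻¹ * ∫ t in Set.Ioi (0 : ℝ), t ^ (p - 1) * φ t) = L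
    generalize log ((Gamma q)⁻¹ * ∫ t in Set.Ioi (0 : ℝ), t ^ (q - 1) * φ t) = M
    have h := div_mul_cancel₀ (L - M) (sub_pos.2 hpq).ne'
    exact ⟨L + p * ((L - M) / (q - p)), (L - M) / (q - p), by ring, by linarith⟩
  have hle := logConcave_moment_ge_exp hφ_nonneg hφ_lc hint hp hpr hrq (exp_pos A) (exp_pos B)
    (hmoment p A B hp hAp) (hmoment q A B hq hAq)
  rw [integral_rpow_mul_exp_exp hr0] at hle
  rw [hAp, hAq, le_log_iff_exp_le (hpos r hr0), le_inv_mul_iff₀ (Gamma_pos_of_pos hr0)]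
  refine le_trans (le_of_eq ?_) hle
  rw [hr]
  ring_nf
end

section
/- Let f: ℝⁿ → [0, ∞) be an integrable function such that 1/f is convex on the support of f (i.e. f is (-1)-concave). Then the function p ↦ p(p-1)⋯(p-n) ∫_{ℝⁿ} f(x)^p dx is log-concave for p > n. -/
open MeasureTheory Real

/-- The one-dimensional Brunn–Minkowski inequality for compact sets. -/
theorem volume_le_of_combo_subset_of_isCompact {A B C : Set ℝ} {a b : ℝ} (ha : 0 ≤ a) (hb : 0 ≤ b)
    (hA : IsCompact A) (hB : IsCompact B) (hA' : A.Nonempty) (hB' : B.Nonempty)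
    (h : ∀ x ∈ A, ∀ y ∈ B, a * x + b * y ∈ C) :
    ENNReal.ofReal a * volume A + ENNReal.ofReal b * volume B ≤ volume C := by
  obtain ⟨s, hs, hsA⟩ := hA.exists_isGreatest hA'
  obtain ⟨t, ht, htB⟩ := hB.exists_isLeast hB'
  have himg : ∀ (c d : ℝ) (_ : 0 ≤ c) (S : Set ℝ),
      volume ((fun x => x + d) '' ((fun x => c • x) '' S)) = ENNReal.ofReal c * volume S := by
    intro c d hc S
    rw [Set.image_add_right, measure_preimage_add_right, Set.image_smul, Measure.addHaar_smul]
    simp [abs_of_nonneg hc]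
  rw [← himg a (b * t) ha A, ← himg b (a * s) hb B, ← measure_union₀]
  · apply measure_mono
    rintro _ (⟨_, ⟨x, hx, rfl⟩, rfl⟩ | ⟨_, ⟨y, hy, rfl⟩, rfl⟩)
    · exact h x hx t ht
    · simpa [add_comm] using h s hs y hy
  · exact (((hB.image (by fun_prop)).image (by fun_prop)).measurableSet).nullMeasurableSet
  · refine measure_mono_null ?_ (measure_singleton (a * s + b * t))
    rintro _ ⟨⟨_, ⟨x, hx, rfl⟩, rfl⟩, ⟨_, ⟨y, hy, rfl⟩, hxy⟩⟩
    have h1 := mul_le_mul_of_nonneg_left (hsA hx) ha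
    have h2 := mul_le_mul_of_nonneg_left (htB hy) hb
    simp only [smul_eq_mul, Set.mem_singleton_iff] at *
    linarith

/-- The one-dimensional Brunn–Minkowski inequality. -/
theorem volume_le_of_combo_subset {A B C : Set ℝ} {a b : ℝ} (ha : 0 ≤ a) (hb : 0 ≤ b)
    (hA : MeasurableSet A) (hB : MeasurableSet B) (hA' : A.Nonempty) (hB' : B.Nonempty)
    (h : ∀ x ∈ A, ∀ y ∈ B, a * x + b * y ∈ C) :
    ENNReal.ofReal a * volume A + ENNReal.ofReal b * volume B ≤ volume C := by
  obtain ⟨x₀, hx₀⟩ := hA'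
  obtain ⟨y₀, hy₀⟩ := hB'
  have key : ∀ K ⊆ A, IsCompact K → ∀ K' ⊆ B, IsCompact K' →
      ENNReal.ofReal a * volume K + ENNReal.ofReal b * volume K' ≤ volume C := by
    intro K hK hKc K' hK' hKc'
    calc _ ≤ ENNReal.ofReal a * volume (insert x₀ K) + ENNReal.ofReal b * volume (insert y₀ K') := by
          gcongr <;> exact Set.subset_insert _ _
      _ ≤ _ := volume_le_of_combo_subset_of_isCompact ha hb (hKc.insert _) (hKc'.insert _)
          (Set.insert_nonempty _ _) (Set.insert_nonempty _ _)
          (fun x hx y hy => h x (Set.insert_subset hx₀ hK hx) y (Set.insert_subset hy₀ hK' hy))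
  have hsup : ∀ S : Set ℝ, MeasurableSet S →
      volume S = ⨆ K : {K : Set ℝ // K ⊆ S ∧ IsCompact K}, volume K.1 := by
    intro S hS
    rw [hS.measure_eq_iSup_isCompact, iSup_subtype]
    simp only [iSup_and]
  have : ∀ S : Set ℝ, Nonempty {K : Set ℝ // K ⊆ S ∧ IsCompact K} :=
    fun S => ⟨⟨∅, Set.empty_subset _, isCompact_empty⟩⟩
  rw [hsup A hA, hsup B hB, ENNReal.mul_iSup, ENNReal.mul_iSup]
  exact ENNReal.iSup_add_iSup_le fun K K' => key K.1 K.2.1 K.2.2 K'.1 K'.2.1 K'.2.2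

/-- The weighted arithmetic-geometric mean inequality for extended nonnegative reals. -/
theorem ennreal_geom_mean_le_arith_mean {a b : ℝ} (ha : 0 < a) (hb : 0 < b) (hab : a + b = 1)
    (x y : ENNReal) : x ^ a * y ^ b ≤ ENNReal.ofReal a * x + ENNReal.ofReal b * y := by
  rcases eq_or_ne x ⊤ with rfl | hx
  · simp [ENNReal.mul_top, ha]
  rcases eq_or_ne y ⊤ with rfl | hy
  · simp [ENNReal.mul_top, hb]
  lift x to NNReal using hx
  lift y to NNReal using hy
  have := NNReal.geom_mean_le_arith_mean2_weighted a.toNNReal b.toNNReal x y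
    (by rw [← Real.toNNReal_add ha.le hb.le, hab, Real.toNNReal_one])
  rw [Real.coe_toNNReal a ha.le, Real.coe_toNNReal b hb.le] at this
  rw [← ENNReal.coe_rpow_of_nonneg _ ha.le, ← ENNReal.coe_rpow_of_nonneg _ hb.le]
  simp only [ENNReal.ofReal]
  exact_mod_cast this

theorem lintegral_eq_lintegral_volume_lt_of_le_one {F : ℝ → ENNReal} (hF : Measurable F)
    (hF1 : ∀ x, F x ≤ 1) :
    ∫⁻ x, F x = ∫⁻ t in Set.Ioo (0 : ℝ) 1, volume {x | ENNReal.ofReal t < F x} := by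
  have hfin : ∀ x, F x ≠ ⊤ := fun x => ne_top_of_le_ne_top ENNReal.one_ne_top (hF1 x)
  have h1 : ∫⁻ x, F x = ∫⁻ x, ENNReal.ofReal (F x).toReal := by
    simp only [ENNReal.ofReal_toReal (hfin _)]
  rw [h1, lintegral_eq_lintegral_meas_lt volume (by filter_upwards with x using ENNReal.toReal_nonneg)
    hF.ennreal_toReal.aemeasurable, ← Set.Ioo_union_Ici_eq_Ioi (zero_lt_one (α := ℝ)),
    lintegral_union measurableSet_Ici (Set.disjoint_left.2 fun x hx hx' => not_le.2 hx.2 hx')]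
  have h2 : ∫⁻ t in Set.Ici (1 : ℝ), volume {x | t < (F x).toReal} = 0 := by
    rw [setLIntegral_congr_fun (g := fun _ => 0) measurableSet_Ici, lintegral_zero]
    intro t ht
    have : {x | t < (F x).toReal} = ∅ := by
      ext x
      have := ENNReal.toReal_mono ENNReal.one_ne_top (hF1 x)
      simp only [ENNReal.toReal_one] at this
      simpa using this.trans ht
    simp [this]
  rw [h2, add_zero]
  refine setLIntegral_congr_fun measurableSet_Ioo fun t ht => ?_
  simp only [ENNReal.ofReal_lt_iff_lt_toReal ht.1.le (hfin _)]

/-- The one-dimensional Prékopa–Leindler inequality for functions with supremum one, in its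
arithmetic form. -/
theorem arith_mean_lintegral_le_of_iSup_eq_one {F G H : ℝ → ENNReal} {a b : ℝ} (ha : 0 < a)
    (hb : 0 < b) (hab : a + b = 1) (hF : Measurable F) (hG : Measurable G) (hH : Measurable H)
    (hF1 : ⨆ x, F x = 1) (hG1 : ⨆ x, G x = 1)
    (h : ∀ x y, F x ^ a * G y ^ b ≤ H (a * x + b * y)) :
    ENNReal.ofReal a * (∫⁻ x, F x) + ENNReal.ofReal b * (∫⁻ x, G x) ≤ ∫⁻ x, H x := by
  have hFle : ∀ x, F x ≤ 1 := fun x => hF1 ▸ le_iSup F x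
  have hGle : ∀ x, G x ≤ 1 := fun x => hG1 ▸ le_iSup G x
  have hmin : ∫⁻ x, min (H x) 1 ≤ ∫⁻ x, H x := lintegral_mono fun x => min_le_left _ _
  refine le_trans ?_ hmin
  rw [lintegral_eq_lintegral_volume_lt_of_le_one hF hFle,
    lintegral_eq_lintegral_volume_lt_of_le_one hG hGle,
    lintegral_eq_lintegral_volume_lt_of_le_one (hH.min measurable_const) fun x => min_le_right _ _]
  have hanti : ∀ F : ℝ → ENNReal, Antitone fun t : ℝ => volume {x | ENNReal.ofReal t < F x} :=
    fun F s t hst => measure_mono fun x (hx : _ < _) => (ENNReal.ofReal_le_ofReal hst).trans_lt hx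
  rw [← lintegral_const_mul _ (hanti F).measurable, ← lintegral_const_mul _ (hanti G).measurable,
    ← lintegral_add_left ((hanti F).measurable.const_mul _)]
  refine setLIntegral_mono (hanti _).measurable fun t ht => ?_
  have ht1 : ENNReal.ofReal t < 1 := by simpa using ht.2
  have ht0 : ENNReal.ofReal t ≠ 0 := by simpa using ht.1
  have hne : ∀ F : ℝ → ENNReal, ⨆ x, F x = 1 → {x | ENNReal.ofReal t < F x}.Nonempty := by
    intro F hF1
    rw [← hF1] at ht1
    exact lt_iSup_iff.1 ht1
  refine volume_le_of_combo_subset ha.le hb.le (hF measurableSet_Ioi) (hG measurableSet_Ioi)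
    (hne F hF1) (hne G hG1) fun x hx y hy => ?_
  refine lt_min (lt_of_lt_of_le ?_ (h x y)) ht1
  calc ENNReal.ofReal t = ENNReal.ofReal t ^ a * ENNReal.ofReal t ^ b := by
        rw [← ENNReal.rpow_add _ _ ht0 ENNReal.ofReal_ne_top, hab, ENNReal.rpow_one]
    _ < F x ^ a * G y ^ b := ENNReal.mul_lt_mul (ENNReal.rpow_lt_rpow hx ha)
        (ENNReal.rpow_lt_rpow hy hb)

/-- The one-dimensional Prékopa–Leindler inequality for bounded functions. -/
theorem prekopa_leindler_real_of_bounded {F G H : ℝ → ENNReal} {a b : ℝ} (ha : 0 < a)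
    (hb : 0 < b) (hab : a + b = 1) (hF : Measurable F) (hG : Measurable G) (hH : Measurable H)
    (hF1 : ⨆ x, F x ≠ ⊤) (hG1 : ⨆ x, G x ≠ ⊤)
    (h : ∀ x y, F x ^ a * G y ^ b ≤ H (a * x + b * y)) :
    (∫⁻ x, F x) ^ a * (∫⁻ x, G x) ^ b ≤ ∫⁻ x, H x := by
  set A := ⨆ x, F x with hA
  set B := ⨆ x, G x with hB
  rcases eq_or_ne A 0 with hA0 | hA0
  · have : ∀ x, F x = 0 := by simpa [hA] using hA0
    simp [this, ha]
  rcases eq_or_ne B 0 with hB0 | hB0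
  · have : ∀ x, G x = 0 := by simpa [hB] using hB0
    simp [this, hb]
  have hAa : A ^ a ≠ 0 ∧ A ^ a ≠ ⊤ := by simp [hA0, hF1, ha]
  have hBb : B ^ b ≠ 0 ∧ B ^ b ≠ ⊤ := by simp [hB0, hG1, hb]
  have key := arith_mean_lintegral_le_of_iSup_eq_one ha hb hab (hF.const_mul A⁻¹)
    (hG.const_mul B⁻¹) (hH.const_mul (A ^ a * B ^ b)⁻¹)
    (by rw [← ENNReal.mul_iSup, ENNReal.inv_mul_cancel hA0 hF1])
    (by rw [← ENNReal.mul_iSup, ENNReal.inv_mul_cancel hB0 hG1]) fun x y => by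
      rw [ENNReal.mul_rpow_of_nonneg _ _ ha.le, ENNReal.mul_rpow_of_nonneg _ _ hb.le,
        ENNReal.inv_rpow, ENNReal.inv_rpow, mul_mul_mul_comm,
        ENNReal.mul_inv (Or.inl hAa.1) (Or.inl hAa.2)]
      gcongr
      exact h x y
  have key2 := (ennreal_geom_mean_le_arith_mean ha hb hab _ _).trans key
  rw [lintegral_const_mul _ hF, lintegral_const_mul _ hG, lintegral_const_mul _ hH,
    ENNReal.mul_rpow_of_nonneg _ _ ha.le, ENNReal.mul_rpow_of_nonneg _ _ hb.le,
    ENNReal.inv_rpow, ENNReal.inv_rpow, mul_mul_mul_comm,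
    ← ENNReal.mul_inv (Or.inl hAa.1) (Or.inl hAa.2)] at key2
  refine (ENNReal.mul_le_mul_iff_right ?_ ?_).1 key2
  · exact ENNReal.inv_ne_zero.2 (ENNReal.mul_ne_top hAa.2 hBb.2)
  · exact ENNReal.inv_ne_top.2 (mul_ne_zero hAa.1 hBb.1)

/-- The one-dimensional Prékopa–Leindler inequality. -/
theorem prekopa_leindler_real {F G H : ℝ → ENNReal} {a b : ℝ} (ha : 0 < a)
    (hb : 0 < b) (hab : a + b = 1) (hF : Measurable F) (hG : Measurable G) (hH : Measurable H)
    (h : ∀ x y, F x ^ a * G y ^ b ≤ H (a * x + b * y)) :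
    (∫⁻ x, F x) ^ a * (∫⁻ x, G x) ^ b ≤ ∫⁻ x, H x := by
  rcases eq_or_ne (∫⁻ x, F x) 0 with hF0 | hF0
  · simp [hF0, ha]
  rcases eq_or_ne (∫⁻ x, G x) 0 with hG0 | hG0
  · simp [hG0, hb]
  have htrunc : ∀ F : ℝ → ENNReal, Measurable F →
      Filter.Tendsto (fun N : ℕ => ∫⁻ x, min (F x) N) Filter.atTop (nhds (∫⁻ x, F x)) := by
    intro F hF
    refine lintegral_tendsto_of_tendsto_of_monotone
      (fun N => (hF.min measurable_const).aemeasurable) ?_ ?_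
    · filter_upwards with x N M hNM
      exact min_le_min_left _ (Nat.cast_le.2 hNM)
    · filter_upwards with x
      simpa using (tendsto_const_nhds (x := F x)).min ENNReal.tendsto_nat_nhds_top
  have hbdd : ∀ (F : ℝ → ENNReal) (N : ℕ), ⨆ x, min (F x) (N : ENNReal) ≠ ⊤ := fun F N =>
    ne_top_of_le_ne_top (ENNReal.natCast_ne_top N) (iSup_le fun x => min_le_right _ _)
  refine le_of_tendsto' (ENNReal.Tendsto.mul ((htrunc F hF).ennrpow_const a) (Or.inl ?_)
    ((htrunc G hG).ennrpow_const b) (Or.inl ?_)) fun N =>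
    prekopa_leindler_real_of_bounded ha hb hab (hF.min measurable_const)
      (hG.min measurable_const) hH (hbdd F N) (hbdd G N) fun x y => le_trans ?_ (h x y)
  · simp [hF0, ha, ha.le]
  · simp [hG0, hb, hb.le]
  · gcongr <;> exact min_le_left _ _

/-- The Prékopa–Leindler inequality on `ℝⁿ`. -/
theorem prekopa_leindler {a b : ℝ} (ha : 0 < a) (hb : 0 < b) (hab : a + b = 1) :
    ∀ (n : ℕ) {F G H : (Fin n → ℝ) → ENNReal}, Measurable F → Measurable G → Measurable H →
    (∀ x y, F x ^ a * G y ^ b ≤ H (a • x + b • y)) →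
    (∫⁻ x, F x) ^ a * (∫⁻ x, G x) ^ b ≤ ∫⁻ x, H x
  | 0, F, G, H, _, _, _, h => by
    have hvol : volume (Set.univ : Set (Fin 0 → ℝ)) = 1 := by simp [volume_pi]
    simp only [lintegral_unique, hvol, mul_one]
    exact (h _ _).trans_eq (congrArg H (Subsingleton.elim _ _))
  | n + 1, F, G, H, hF, hG, hH, h => by
    let e := MeasurableEquiv.piFinSuccAbove (fun _ : Fin (n + 1) => ℝ) 0
    have he : Measurable e.symm := e.symm.measurable
    have hfub : ∀ F : (Fin (n + 1) → ℝ) → ENNReal, Measurable F →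
        ∫⁻ x, F x = ∫⁻ s : ℝ, ∫⁻ x : Fin n → ℝ, F (e.symm (s, x)) := by
      intro F hF
      rw [← (volume_preserving_piFinSuccAbove (fun _ : Fin (n + 1) => ℝ) 0).symm.lintegral_comp hF]
      exact lintegral_prod _ (hF.comp he).aemeasurable
    rw [hfub F hF, hfub G hG, hfub H hH]
    refine prekopa_leindler_real ha hb hab (hF.comp he).lintegral_prod_right'
      (hG.comp he).lintegral_prod_right' (hH.comp he).lintegral_prod_right' fun s t => ?_
    refine prekopa_leindler ha hb hab n ((hF.comp he).comp measurable_prodMk_left)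
      ((hG.comp he).comp measurable_prodMk_left) ((hH.comp he).comp measurable_prodMk_left)
      fun x y => ?_
    have : e.symm (a * s + b * t, a • x + b • y) = a • e.symm (s, x) + b • e.symm (t, y) := by
      ext i
      refine Fin.cases ?_ (fun i => ?_) i <;> simp [e, MeasurableEquiv.piFinSuccAbove, Fin.insertNthEquiv]
    simp only [this]
    exact h _ _

theorem ConcaveOn.combo_le_mul_of_lt {S : Set ℝ} {f : ℝ → ℝ} (hf : ConcaveOn ℝ S f) {x y z : ℝ}
    (hx : x ∈ S) (hz : z ∈ S) (hxy : x < y) (hyz : y < z) :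
    (z - y) * f x + (y - x) * f z ≤ (z - x) * f y := by
  have h := hf.slope_anti_adjacent hx hz hxy hyz
  rw [div_le_div_iff₀ (sub_pos.2 hyz) (sub_pos.2 hxy)] at h
  linarith

/-- An interval is the superlevel set of `s ^ θ` minus a suitable affine function. -/
theorem exists_affine_crossing_rpow {θ : ℝ} (h0 : 0 < θ) (h1 : θ < 1) {I : Set ℝ}
    (hI : I.OrdConnected) (hpos : ∀ s ∈ I, 0 < s) :
    ∃ α β : ℝ, ∀ s, 0 < s →
      (s ∈ I → α + β * s ≤ s ^ θ) ∧ (s ∉ I → s ^ θ ≤ α + β * s) := by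
  rcases I.eq_empty_or_nonempty with rfl | hne
  · refine ⟨1, 1, fun s hs => ⟨fun h => h.elim, fun _ => ?_⟩⟩
    have := rpow_one_add_le_one_add_mul_self (s := s - 1) (by linarith) h0.le h1.le
    rw [add_sub_cancel] at this
    nlinarith
  have hbb : BddBelow I := ⟨0, fun s hs => (hpos s hs).le⟩
  have hinf0 : 0 ≤ sInf I := le_csInf hne fun s hs => (hpos s hs).le
  by_cases hba : BddAbove I
  · have hout : ∀ s ∉ I, s ≤ sInf I ∨ sSup I ≤ s := by
      intro s hs
      by_contra! hcon
      obtain ⟨i, hi, his⟩ := exists_lt_of_csInf_lt hne hcon.1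
      obtain ⟨j, hj, hjs⟩ := exists_lt_of_lt_csSup hne hcon.2
      exact hs (hI.out hi hj ⟨his.le, hjs.le⟩)
    have hle : sInf I ≤ sSup I :=
      hne.elim fun i hi => (csInf_le hbb hi).trans (le_csSup hba hi)
    rcases hle.eq_or_lt with heq | hlt
    · obtain ⟨i, hi⟩ := hne
      have hi0 := hpos i hi
      have huniq : ∀ s ∈ I, s = i := fun s hs => by
        linarith [csInf_le hbb hs, le_csSup hba hs, csInf_le hbb hi, le_csSup hba hi]
      refine ⟨i ^ θ - i ^ θ * θ, i ^ θ * θ / i, fun s hs => ⟨fun h => ?_, fun _ => ?_⟩⟩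
      · rw [huniq s h, div_mul_cancel₀ _ hi0.ne']
        linarith
      · have := rpow_one_add_le_one_add_mul_self (s := s / i - 1)
          (by linarith [div_pos hs hi0]) h0.le h1.le
        rw [add_sub_cancel, div_rpow hs.le hi0.le, div_le_iff₀ (rpow_pos_of_pos hi0 _)] at this
        refine this.trans_eq ?_
        ring
    · have hsup0 : 0 ≤ sSup I := hinf0.trans hlt.le
      have hc := concaveOn_rpow h0.le h1.le
      set x := sInf I
      set z := sSup I
      have hzx : 0 < z - x := sub_pos.2 hlt
      refine ⟨x ^ θ - (z ^ θ - x ^ θ) / (z - x) * x, (z ^ θ - x ^ θ) / (z - x), fun s hs => ?_⟩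
      have hrw : x ^ θ - (z ^ θ - x ^ θ) / (z - x) * x + (z ^ θ - x ^ θ) / (z - x) * s
          = ((z - s) * x ^ θ + (s - x) * z ^ θ) / (z - x) := by
        field_simp
        ring
      rw [hrw, div_le_iff₀ hzx, le_div_iff₀ hzx]
      constructor
      · intro h
        rcases (csInf_le hbb h : x ≤ s).eq_or_lt with h2 | h2
        · rw [← h2]
          linarith
        rcases (le_csSup hba h : s ≤ z).eq_or_lt with h3 | h3
        · rw [h3]
          linarith
        linarith [hc.combo_le_mul_of_lt hinf0 hsup0 h2 h3]
      · intro h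
        rcases hout s h with h2 | h2
        · rcases h2.eq_or_lt with h2 | h2
          · rw [h2]
            linarith
          linarith [hc.combo_le_mul_of_lt (Set.mem_Ici.2 hs.le) hsup0 h2 hlt]
        · rcases h2.eq_or_lt with h2 | h2
          · rw [← h2]
            linarith
          linarith [hc.combo_le_mul_of_lt hinf0 (Set.mem_Ici.2 hs.le) hlt h2]
  · refine ⟨sInf I ^ θ, 0, fun s hs => ⟨fun h => ?_, fun h => ?_⟩⟩
    · simpa using rpow_le_rpow hinf0 (csInf_le hbb h) h0.le
    · rw [zero_mul, add_zero]
      refine rpow_le_rpow hs.le (le_of_not_gt fun hlt => h ?_) h0.le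
      obtain ⟨i, hi, his⟩ := exists_lt_of_csInf_lt hne hlt
      obtain ⟨j, hj, hjs⟩ := not_bddAbove_iff.1 hba s
      exact hI.out hi hj ⟨his.le, hjs.le⟩

theorem integrableOn_rpow_mul_exp_neg_mul_Ioi {q r : ℝ} (hq : 0 < q) (hr : 0 < r) :
    IntegrableOn (fun t : ℝ => t ^ (q - 1) * exp (-(r * t))) (Set.Ioi 0) := by
  refine Integrable.of_integral_ne_zero ?_
  rw [integral_rpow_mul_exp_neg_mul_Ioi hq hr]
  have := Gamma_pos_of_pos hq
  positivity

theorem setIntegral_rpow_mul_pos {φ : ℝ → ℝ} (hpos : ∀ t, 0 < t → 0 < φ t) {q : ℝ}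
    (hint : IntegrableOn (fun t => t ^ (q - 1) * φ t) (Set.Ioi 0)) :
    0 < ∫ t in Set.Ioi 0, t ^ (q - 1) * φ t := by
  have hp : ∀ t ∈ Set.Ioi (0 : ℝ), 0 < t ^ (q - 1) * φ t := fun t ht =>
    mul_pos (rpow_pos_of_pos ht _) (hpos t ht)
  rw [setIntegral_pos_iff_support_of_nonneg_ae _ hint]
  · refine lt_of_lt_of_le ?_ (measure_mono (s := Set.Ioi (0 : ℝ)) fun t ht => ⟨(hp t ht).ne', ht⟩)
    simp
  · exact (ae_restrict_iff' measurableSet_Ioi).2 (.of_forall fun t ht => (hp t ht).le)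

/-- Two exponential moments of a log-concave function dominate the intermediate ones. -/
theorem moment_exp_le_moment_of_logConcave {φ : ℝ → ℝ} (hpos : ∀ t, 0 < t → 0 < φ t)
    (hconc : ConcaveOn ℝ (Set.Ioi 0) fun t => log (φ t))
    (hint : ∀ q : ℝ, 0 < q → IntegrableOn (fun t => t ^ (q - 1) * φ t) (Set.Ioi 0))
    {A r x y a b : ℝ} (hA : 0 < A) (hr : 0 < r) (hx : 0 < x) (hxy : x < y) (ha : 0 < a)
    (hb : 0 < b) (hab : a + b = 1)
    (h0 : ∫ t in Set.Ioi 0, t ^ (x - 1) * φ t = A * ((1 / r) ^ x * Gamma x))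
    (h1 : ∫ t in Set.Ioi 0, t ^ (y - 1) * φ t = A * ((1 / r) ^ y * Gamma y)) :
    A * ((1 / r) ^ (a * x + b * y) * Gamma (a * x + b * y)) ≤
      ∫ t in Set.Ioi 0, t ^ (a * x + b * y - 1) * φ t := by
  have hy : 0 < y := hx.trans hxy
  set q := a * x + b * y with hq_def
  have hq : 0 < q := by positivity
  have hd : 0 < y - x := sub_pos.2 hxy
  set E : ℝ → ℝ := fun t => A * exp (-(r * t)) with hE
  have hEint : ∀ q : ℝ, 0 < q → IntegrableOn (fun t => t ^ (q - 1) * E t) (Set.Ioi 0) := by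
    intro q hq
    have := (integrableOn_rpow_mul_exp_neg_mul_Ioi hq hr).const_mul A
    refine this.congr (.of_forall fun t => ?_)
    simp only [hE]
    ring
  have hEval : ∀ q : ℝ, 0 < q → ∫ t in Set.Ioi 0, t ^ (q - 1) * E t = A * ((1 / r) ^ q * Gamma q) := by
    intro q hq
    rw [← integral_rpow_mul_exp_neg_mul_Ioi hq hr, ← integral_const_mul]
    congr 1
    ext t
    simp only [hE]
    ring
  have hDint : ∀ q : ℝ, 0 < q → IntegrableOn (fun t => t ^ (q - 1) * (φ t - E t)) (Set.Ioi 0) := by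
    intro q hq
    simpa only [mul_sub] using! (hint q hq).sub (hEint q hq)
  have hDval : ∀ q : ℝ, 0 < q → ∫ t in Set.Ioi 0, t ^ (q - 1) * (φ t - E t) =
      (∫ t in Set.Ioi 0, t ^ (q - 1) * φ t) - A * ((1 / r) ^ q * Gamma q) := by
    intro q hq
    rw [← hEval q hq, ← integral_sub (hint q hq) (hEint q hq)]
    simp only [mul_sub]
  have hord : {t : ℝ | 0 < t ∧ E t ≤ φ t}.OrdConnected := by
    have h2 : ConcaveOn ℝ (Set.Ioi 0) fun t => log (φ t) + r * t :=
      hconc.add ((LinearMap.mulLeft ℝ r).concaveOn (convex_Ioi 0))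
    have h3 := (h2.convex_ge (log A)).ordConnected
    convert! h3 using 1
    ext t
    refine and_congr_right fun ht => ?_
    rw [← log_le_log_iff (by positivity) (hpos t ht), hE, log_mul hA.ne' (exp_pos _).ne', log_exp]
    constructor <;> intro h <;> linarith
  set I : Set ℝ := {s | 0 < s ∧ E (s ^ (1 / (y - x))) ≤ φ (s ^ (1 / (y - x)))}
  have hI : I.OrdConnected := by
    refine ⟨fun s hs u hu v hv => ?_⟩
    have hv0 : 0 < v := hs.1.trans_le hv.1
    refine ⟨hv0, (hord.out (x := s ^ (1 / (y - x))) (y := u ^ (1 / (y - x)))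
      ⟨rpow_pos_of_pos hs.1 _, hs.2⟩ ⟨rpow_pos_of_pos hu.1 _, hu.2⟩ ⟨?_, ?_⟩).2⟩
    · exact rpow_le_rpow hs.1.le hv.1 (by positivity)
    · exact rpow_le_rpow hv0.le hv.2 (by positivity)
  obtain ⟨α, β, hαβ⟩ := exists_affine_crossing_rpow hb (by linarith) hI fun s hs => hs.1
  have hpt : ∀ t ∈ Set.Ioi (0 : ℝ), 0 ≤ t ^ (q - 1) * (φ t - E t) -
      (α * (t ^ (x - 1) * (φ t - E t)) + β * (t ^ (y - 1) * (φ t - E t))) := by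
    intro t (ht : 0 < t)
    have hs : (t ^ (y - x)) ^ (1 / (y - x)) = t := by
      rw [← rpow_mul ht.le, mul_one_div_cancel hd.ne', rpow_one]
    have e1 : t ^ (q - 1) = t ^ (x - 1) * (t ^ (y - x)) ^ b := by
      rw [← rpow_mul ht.le, ← rpow_add ht]
      congr 1
      linear_combination hq_def + x * hab
    have e2 : t ^ (y - 1) = t ^ (x - 1) * t ^ (y - x) := by
      rw [← rpow_add ht]
      congr 1
      ring
    have e3 : t ^ (q - 1) * (φ t - E t) -
      (α * (t ^ (x - 1) * (φ t - E t)) + β * (t ^ (y - 1) * (φ t - E t))) =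
      t ^ (x - 1) * (((t ^ (y - x)) ^ b - (α + β * t ^ (y - x))) * (φ t - E t)) := by
      rw [e1, e2]
      ring
    rw [e3]
    have hst := rpow_pos_of_pos ht (y - x)
    refine mul_nonneg (rpow_nonneg ht.le _) ?_
    by_cases hmem : E t ≤ φ t
    · have := (hαβ _ hst).1 ⟨hst, by rwa [hs]⟩
      exact mul_nonneg (by linarith) (by linarith)
    · have := (hαβ _ hst).2 fun h => hmem (by simpa only [hs] using h.2)
      exact mul_nonneg_of_nonpos_of_nonpos (by linarith) (by linarith [not_le.1 hmem])
  have hge := setIntegral_nonneg (μ := volume) measurableSet_Ioi hpt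
  rw [integral_sub (hDint q hq) (((hDint x hx).const_mul α).fun_add ((hDint y hy).const_mul β)),
    integral_add ((hDint x hx).const_mul α) ((hDint y hy).const_mul β), integral_const_mul,
    integral_const_mul, hDval q hq, hDval x hx, hDval y hy, h0, h1] at hge
  linarith

/-- Borell's theorem: the normalized Mellin transform of a log-concave function is log-concave. -/
theorem concaveOn_log_mellin_div_Gamma {φ : ℝ → ℝ} (hpos : ∀ t, 0 < t → 0 < φ t)
    (hconc : ConcaveOn ℝ (Set.Ioi 0) fun t => log (φ t))
    (hint : ∀ q : ℝ, 0 < q → IntegrableOn (fun t => t ^ (q - 1) * φ t) (Set.Ioi 0)) :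
    ConcaveOn ℝ (Set.Ioi 0)
      fun q => log ((∫ t in Set.Ioi 0, t ^ (q - 1) * φ t) / Gamma q) := by
  refine LinearOrder.concaveOn_of_lt (convex_Ioi 0) ?_
  intro x (hx : 0 < x) y (hy : 0 < y) hxy a b ha hb hab
  set M : ℝ → ℝ := fun q => (∫ t in Set.Ioi 0, t ^ (q - 1) * φ t) / Gamma q with hM
  have hMpos : ∀ q : ℝ, 0 < q → 0 < M q := fun q hq =>
    div_pos (setIntegral_rpow_mul_pos hpos (hint q hq)) (Gamma_pos_of_pos hq)
  have hd : y - x ≠ 0 := (sub_pos.2 hxy).ne'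
  set ρ := (log (M x) - log (M y)) / (y - x) with hρ
  set κ := log (M x) + x * ρ with hκ
  have hρd : ρ * (y - x) = log (M x) - log (M y) := div_mul_cancel₀ _ hd
  have hexp : ∀ q, exp κ * ((1 / exp ρ) ^ q * Gamma q) = exp (κ - q * ρ) * Gamma q := by
    intro q
    rw [one_div, ← exp_neg, ← exp_mul, ← mul_assoc, ← exp_add]
    ring_nf
  have hval : ∀ q : ℝ, 0 < q → log (M q) = κ - q * ρ →
      ∫ t in Set.Ioi 0, t ^ (q - 1) * φ t = exp κ * ((1 / exp ρ) ^ q * Gamma q) := by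
    intro q hq h
    rw [hexp, ← h, exp_log (hMpos q hq), div_mul_cancel₀ _ (Gamma_pos_of_pos hq).ne']
  have hq : 0 < a * x + b * y := by positivity
  have hx' : log (M x) = κ - x * ρ := by rw [hκ]; ring
  have hy' : log (M y) = κ - y * ρ := by rw [hκ]; linarith
  have key := moment_exp_le_moment_of_logConcave hpos hconc hint (exp_pos κ) (exp_pos ρ) hx hxy
    ha hb hab (hval x hx hx') (hval y hy hy')
  rw [hexp, ← le_div_iff₀ (Gamma_pos_of_pos hq)] at key
  have key2 := (le_log_iff_exp_le (hMpos _ hq)).2 key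
  change a * log (M x) + b * log (M y) ≤ log (M (a * x + b * y))
  refine le_trans (le_of_eq ?_) key2
  rw [hx', hy']
  linear_combination (κ) * hab

/-- A concave function on an open subset of `ℝ` lies below an affine function touching it. -/
theorem ConcaveOn.exists_le_add_mul_sub {S : Set ℝ} {f : ℝ → ℝ} (hf : ConcaveOn ℝ S f)
    (hS : IsOpen S) {x : ℝ} (hx : x ∈ S) : ∃ m, ∀ y ∈ S, f y ≤ f x + m * (y - x) := by
  have hx' : x ∈ interior S := by rwa [hS.interior_eq]
  refine ⟨-derivWithin (-f) (Set.Ioi x) x, fun y hy => ?_⟩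
  rcases lt_trichotomy y x with h | rfl | h
  · have h1 := (hf.neg.slope_le_leftDeriv_of_mem_interior hy hx' h).trans
      (hf.neg.leftDeriv_le_rightDeriv_of_mem_interior hx')
    rw [slope_def_field, div_le_iff₀ (sub_pos.2 h)] at h1
    simp only [Pi.neg_apply] at h1
    linarith
  · simp
  · have h1 := hf.neg.rightDeriv_le_slope_of_mem_interior hx' hy h
    rw [slope_def_field, le_div_iff₀ (sub_pos.2 h)] at h1
    simp only [Pi.neg_apply] at h1
    linarith

/-- If one moment of a log-concave function is finite, then so are all of them. -/
theorem integrableOn_rpow_mul_of_logConcave {φ : ℝ → ℝ} (hpos : ∀ t, 0 < t → 0 < φ t)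
    (hconc : ConcaveOn ℝ (Set.Ioi 0) fun t => log (φ t)) {p q : ℝ} (hp : 0 < p)
    (hint : IntegrableOn (fun t => t ^ (p - 1) * φ t) (Set.Ioi 0)) (hq : 0 < q) :
    IntegrableOn (fun t => t ^ (q - 1) * φ t) (Set.Ioi 0) := by
  have hcont : ContinuousOn φ (Set.Ioi 0) := by
    refine ((hconc.continuousOn isOpen_Ioi).rexp).congr fun t ht => ?_
    exact (exp_log (hpos t ht)).symm
  obtain ⟨t₁, t₂, ht₁, ht₂, hlt⟩ : ∃ t₁ t₂, 0 < t₁ ∧ t₁ < t₂ ∧ φ t₂ < φ t₁ := by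
    by_contra! hmono
    have h1 : IntegrableOn (fun t : ℝ => t ^ (p - 1)) (Set.Ioi 1) := by
      have h2 := (hint.mono_set (Set.Ioi_subset_Ioi zero_le_one)).const_mul (φ 1)⁻¹
      refine h2.mono' (by fun_prop) ?_
      refine (ae_restrict_iff' measurableSet_Ioi).2 (.of_forall fun t (ht : 1 < t) => ?_)
      have h0 : 0 < t := by linarith
      have h3 := hmono 1 t one_pos ht
      have h4 := hpos 1 one_pos
      have h5 := rpow_pos_of_pos h0 (p - 1)
      rw [norm_of_nonneg h5.le, ← mul_assoc, mul_comm (φ 1)⁻¹, mul_assoc, inv_mul_eq_div]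
      exact le_mul_of_one_le_right h5.le ((one_le_div h4).2 h3)
    rw [integrableOn_Ioi_rpow_iff one_pos] at h1
    linarith
  have ht₂0 : 0 < t₂ := ht₁.trans ht₂
  obtain ⟨m, hm⟩ := hconc.exists_le_add_mul_sub isOpen_Ioi (Set.mem_Ioi.2 ht₂0)
  have hm0 : 0 < -m := by
    have h1 := hm t₁ (Set.mem_Ioi.2 ht₁)
    have h2 := log_lt_log (hpos t₂ ht₂0) hlt
    nlinarith
  have hbd := (integrableOn_rpow_mul_exp_neg_mul_Ioi hq hm0).const_mul (exp (log (φ t₂) - m * t₂))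
  refine hbd.mono' ?_ ?_
  · refine ContinuousOn.aestronglyMeasurable (ContinuousOn.mul ?_ hcont) measurableSet_Ioi
    exact fun t ht => (continuousAt_rpow_const _ _ (Or.inl (ne_of_gt ht))).continuousWithinAt
  · refine (ae_restrict_iff' measurableSet_Ioi).2 (.of_forall fun t (ht : 0 < t) => ?_)
    have h5 := rpow_pos_of_pos ht (q - 1)
    have h6 := hpos t ht
    rw [norm_of_nonneg (mul_pos h5 h6).le, mul_left_comm, ← exp_add]
    refine mul_le_mul_of_nonneg_left ?_ h5.le
    rw [← log_le_iff_le_exp h6]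
    linarith [hm t ht]

/-- The function `exp (-t / f)`, extended by zero outside the support of `f`. -/
noncomputable def expNegDiv {n : ℕ} (f : (Fin n → ℝ) → ℝ) (t : ℝ) (x : Fin n → ℝ) : ENNReal :=
  if 0 < f x then ENNReal.ofReal (exp (-((f x)⁻¹ * t))) else 0

/-- The integral of the perspective of `exp (-1 / f)`. -/
noncomputable def perspectiveIntegral {n : ℕ} (f : (Fin n → ℝ) → ℝ) (t : ℝ) : ENNReal :=
  ENNReal.ofReal (t ^ n) * ∫⁻ x, expNegDiv f t x

section

variable {n : ℕ} {f : (Fin n → ℝ) → ℝ}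

theorem measurable_expNegDiv_uncurry (hf : Measurable f) :
    Measurable fun z : ℝ × (Fin n → ℝ) => expNegDiv f z.1 z.2 := by
  have hf2 : Measurable fun z : ℝ × (Fin n → ℝ) => f z.2 := hf.comp measurable_snd
  unfold expNegDiv
  refine Measurable.ite (measurableSet_lt measurable_const hf2) ?_ measurable_const
  fun_prop

theorem measurable_expNegDiv (hf : Measurable f) (t : ℝ) : Measurable (expNegDiv f t) :=
  (measurable_expNegDiv_uncurry hf).comp measurable_prodMk_left

theorem measurable_perspectiveIntegral (hf : Measurable f) :
    Measurable (perspectiveIntegral f) :=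
  (by fun_prop : Measurable fun t : ℝ => ENNReal.ofReal (t ^ n)).mul
    (measurable_expNegDiv_uncurry hf).lintegral_prod_right'

theorem lintegral_comp_inv_smul {G : (Fin n → ℝ) → ENNReal} (hG : Measurable G) {t : ℝ}
    (ht : 0 < t) : ∫⁻ y, G (t⁻¹ • y) = ENNReal.ofReal (t ^ n) * ∫⁻ x, G x := by
  have h := lintegral_map (μ := volume) hG (measurable_const_smul (t⁻¹ : ℝ) (α := Fin n → ℝ))
  rw [← h, Measure.map_addHaar_smul volume (inv_ne_zero ht.ne'), lintegral_smul_measure]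
  simp [abs_of_pos ht]

theorem expNegDiv_rpow_mul_le (hf : ConvexOn ℝ {x | 0 < f x} fun x => (f x)⁻¹) {s t a b : ℝ}
    (hs : 0 < s) (ht : 0 < t) (ha : 0 < a) (hb : 0 < b) (x y : Fin n → ℝ) :
    expNegDiv f s (s⁻¹ • x) ^ a * expNegDiv f t (t⁻¹ • y) ^ b ≤
      expNegDiv f (a * s + b * t) ((a * s + b * t)⁻¹ • (a • x + b • y)) := by
  have hr : 0 < a * s + b * t := by positivity
  set r := a * s + b * t with hr_def
  have hw : r⁻¹ • (a • x + b • y) = (a * s / r) • (s⁻¹ • x) + (b * t / r) • (t⁻¹ • y) := by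
    simp only [smul_add, smul_smul]
    congr 2 <;> field_simp
  rw [hw]
  set u := s⁻¹ • x
  set v := t⁻¹ • y
  by_cases hu : 0 < f u
  swap
  · simp [expNegDiv, hu, ha]
  by_cases hv : 0 < f v
  swap
  · simp [expNegDiv, hv, hb]
  have hsum : a * s / r + b * t / r = 1 := by rw [← add_div, ← hr_def, div_self hr.ne']
  have ha' : 0 ≤ a * s / r := by positivity
  have hb' : 0 ≤ b * t / r := by positivity
  have hmem : 0 < f ((a * s / r) • u + (b * t / r) • v) := hf.1 hu hv ha' hb' hsum
  have hle := hf.2 hu hv ha' hb' hsum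
  simp only [smul_eq_mul] at hle
  simp only [expNegDiv, hu, hv, hmem, if_true]
  rw [ENNReal.ofReal_rpow_of_pos (exp_pos _), ENNReal.ofReal_rpow_of_pos (exp_pos _),
    ← ENNReal.ofReal_mul (by positivity), ← exp_mul, ← exp_mul, ← exp_add]
  refine ENNReal.ofReal_le_ofReal (exp_le_exp.2 ?_)
  have h2 := mul_le_mul_of_nonneg_right hle hr.le
  have h3 : (a * s / r * (f u)⁻¹ + b * t / r * (f v)⁻¹) * r =
      a * s * (f u)⁻¹ + b * t * (f v)⁻¹ := by
    field_simp
  linarith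

theorem perspectiveIntegral_rpow_mul_le (hm : Measurable f)
    (hf : ConvexOn ℝ {x | 0 < f x} fun x => (f x)⁻¹) {s t a b : ℝ} (hs : 0 < s) (ht : 0 < t)
    (ha : 0 < a) (hb : 0 < b) (hab : a + b = 1) :
    perspectiveIntegral f s ^ a * perspectiveIntegral f t ^ b ≤
      perspectiveIntegral f (a * s + b * t) := by
  have hr : 0 < a * s + b * t := by positivity
  unfold perspectiveIntegral
  rw [← lintegral_comp_inv_smul (measurable_expNegDiv hm s) hs,
    ← lintegral_comp_inv_smul (measurable_expNegDiv hm t) ht,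
    ← lintegral_comp_inv_smul (measurable_expNegDiv hm _) hr]
  have hmeas : ∀ r : ℝ, Measurable fun x : Fin n → ℝ => expNegDiv f r (r⁻¹ • x) := fun r =>
    (measurable_expNegDiv hm r).comp (measurable_const_smul _)
  exact prekopa_leindler ha hb hab n (hmeas s) (hmeas t) (hmeas _)
    (expNegDiv_rpow_mul_le hf hs ht ha hb)

theorem perspectiveIntegral_ne_top (hint : Integrable f) {t : ℝ} (ht : 0 < t) :
    perspectiveIntegral f t ≠ ⊤ := by
  refine ENNReal.mul_ne_top ENNReal.ofReal_ne_top ?_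
  have h1 : ∫⁻ x, ENNReal.ofReal (t⁻¹ * f x) ≠ ⊤ := (hint.const_mul t⁻¹).lintegral_lt_top.ne
  refine ne_top_of_le_ne_top h1 (lintegral_mono fun x => ?_)
  unfold expNegDiv
  split_ifs with hx
  · refine ENNReal.ofReal_le_ofReal ?_
    have hu : 0 < (f x)⁻¹ * t := by positivity
    have : t⁻¹ * f x = ((f x)⁻¹ * t)⁻¹ := by
      rw [mul_inv, inv_inv, mul_comm]
    rw [this, exp_neg]
    exact inv_anti₀ hu (by linarith [add_one_le_exp ((f x)⁻¹ * t)])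
  · exact zero_le

theorem perspectiveIntegral_ne_zero (hm : Measurable f) (hvol : volume {x | 0 < f x} ≠ 0) {t : ℝ}
    (ht : 0 < t) : perspectiveIntegral f t ≠ 0 := by
  refine mul_ne_zero (by simpa using pow_pos ht n) ?_
  refine ((lintegral_pos_iff_support (measurable_expNegDiv hm t)).2 ?_).ne'
  refine (pos_iff_ne_zero.2 hvol).trans_le (measure_mono fun x (hx : 0 < f x) => ?_)
  simp [expNegDiv, hx, exp_pos]

theorem lintegral_rpow_mul_exp_neg_mul_Ioi {p r : ℝ} (hp : 0 < p) (hr : 0 < r) :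
    ∫⁻ t in Set.Ioi 0, ENNReal.ofReal (t ^ (p - 1)) * ENNReal.ofReal (exp (-(r * t))) =
      ENNReal.ofReal ((1 / r) ^ p * Gamma p) := by
  rw [← integral_rpow_mul_exp_neg_mul_Ioi hp hr, ofReal_integral_eq_lintegral_ofReal
    (integrableOn_rpow_mul_exp_neg_mul_Ioi hp hr)]
  · refine setLIntegral_congr_fun measurableSet_Ioi fun t (ht : 0 < t) => ?_
    simp only [ENNReal.ofReal_mul (rpow_nonneg ht.le (p - 1))]
  · refine (ae_restrict_iff' measurableSet_Ioi).2 (.of_forall fun t (ht : 0 < t) => ?_)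
    have := rpow_nonneg ht.le (p - 1)
    simp only [Pi.zero_apply]
    positivity

/-- The Mellin transform of `perspectiveIntegral f` computes the integrals of powers of `f`. -/
theorem lintegral_rpow_mul_perspectiveIntegral (hm : Measurable f) (h0 : ∀ x, 0 ≤ f x) {p : ℝ}
    (hp : 0 < p) :
    ∫⁻ t in Set.Ioi 0, ENNReal.ofReal (t ^ (p - n - 1)) * perspectiveIntegral f t =
      ENNReal.ofReal (Gamma p) * ∫⁻ x, ENNReal.ofReal (f x ^ p) := by
  have hmr : Measurable fun t : ℝ => ENNReal.ofReal (t ^ (p - 1)) := by fun_prop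
  calc _ = ∫⁻ t in Set.Ioi 0, ∫⁻ x, ENNReal.ofReal (t ^ (p - 1)) * expNegDiv f t x := by
        refine setLIntegral_congr_fun measurableSet_Ioi fun t (ht : 0 < t) => ?_
        simp only [perspectiveIntegral]
        rw [lintegral_const_mul _ (measurable_expNegDiv hm t), ← mul_assoc,
          ← ENNReal.ofReal_mul (rpow_nonneg ht.le _), ← rpow_natCast, ← rpow_add ht]
        congr 3
        ring
    _ = ∫⁻ x, ∫⁻ t in Set.Ioi 0, ENNReal.ofReal (t ^ (p - 1)) * expNegDiv f t x := by
        refine lintegral_lintegral_swap (Measurable.aemeasurable ?_)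
        exact (hmr.comp measurable_fst).mul (measurable_expNegDiv_uncurry hm)
    _ = ∫⁻ x, ENNReal.ofReal (Gamma p) * ENNReal.ofReal (f x ^ p) := by
        refine lintegral_congr fun x => ?_
        by_cases hx : 0 < f x
        · simp only [expNegDiv, hx, if_true]
          rw [lintegral_rpow_mul_exp_neg_mul_Ioi hp (inv_pos.2 hx), one_div, inv_inv, mul_comm,
            ENNReal.ofReal_mul (Gamma_pos_of_pos hp).le]
        · have : f x = 0 := le_antisymm (not_lt.1 hx) (h0 x)
          simp [expNegDiv, this, zero_rpow hp.ne']
    _ = _ := lintegral_const_mul _ (by fun_prop)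

theorem prod_range_sub_mul_Gamma (m : ℕ) {p : ℝ} (hp : (m : ℝ) - 1 < p) :
    (∏ i ∈ Finset.range m, (p - (i : ℝ))) * Gamma (p - m + 1) = Gamma (p + 1) := by
  induction m with
  | zero => simp
  | succ m ih =>
    push_cast at hp
    rw [← ih (by linarith), Finset.prod_range_succ, Gamma_add_one (by linarith : p - m ≠ 0)]
    push_cast
    ring_nf

theorem lintegral_ofReal_rpow_mul_perspectiveIntegral (hm : Measurable f) (h0 : ∀ x, 0 ≤ f x)
    (hint : Integrable f) {p : ℝ} (hp : 0 < p) :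
    ∫⁻ t in Set.Ioi 0, ENNReal.ofReal (t ^ (p - n - 1) * (perspectiveIntegral f t).toReal) =
      ENNReal.ofReal (Gamma p) * ∫⁻ x, ENNReal.ofReal (f x ^ p) := by
  rw [← lintegral_rpow_mul_perspectiveIntegral hm h0 hp]
  refine setLIntegral_congr_fun measurableSet_Ioi fun t (ht : 0 < t) => ?_
  simp only [ENNReal.ofReal_mul (rpow_nonneg ht.le (p - n - 1)),
    ENNReal.ofReal_toReal (perspectiveIntegral_ne_top hint ht)]

theorem ae_nonneg_rpow_mul_toReal (Φ : ℝ → ENNReal) (q : ℝ) :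
    0 ≤ᵐ[volume.restrict (Set.Ioi 0)] fun t => t ^ q * (Φ t).toReal :=
  (ae_restrict_iff' measurableSet_Ioi).2 (.of_forall fun _ ht =>
    mul_nonneg (rpow_nonneg (le_of_lt ht) _) ENNReal.toReal_nonneg)

theorem measurable_rpow_mul_perspectiveIntegral (hm : Measurable f) (q : ℝ) :
    Measurable fun t => t ^ q * (perspectiveIntegral f t).toReal :=
  (measurable_id.pow_const q).mul (measurable_perspectiveIntegral hm).ennreal_toReal

theorem integrable_rpow_iff_integrableOn_perspectiveIntegral (hm : Measurable f)
    (h0 : ∀ x, 0 ≤ f x) (hint : Integrable f) {p : ℝ} (hp : 0 < p) :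
    Integrable (fun x => f x ^ p) ↔
      IntegrableOn (fun t => t ^ (p - n - 1) * (perspectiveIntegral f t).toReal) (Set.Ioi 0) := by
  rw [← lintegral_ofReal_ne_top_iff_integrable (hm.pow_const p).aestronglyMeasurable
      (.of_forall fun x => rpow_nonneg (h0 x) p), IntegrableOn,
    ← lintegral_ofReal_ne_top_iff_integrable
      (measurable_rpow_mul_perspectiveIntegral hm _).aestronglyMeasurable
      (ae_nonneg_rpow_mul_toReal _ _),
    lintegral_ofReal_rpow_mul_perspectiveIntegral hm h0 hint hp]
  have := Gamma_pos_of_pos hp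
  simp [ENNReal.mul_eq_top, this]

theorem setIntegral_rpow_mul_perspectiveIntegral (hm : Measurable f)
    (h0 : ∀ x, 0 ≤ f x) (hint : Integrable f) {p : ℝ} (hp : 0 < p) :
    ∫ t in Set.Ioi 0, t ^ (p - n - 1) * (perspectiveIntegral f t).toReal =
      Gamma p * ∫ x, f x ^ p := by
  rw [integral_eq_lintegral_of_nonneg_ae (ae_nonneg_rpow_mul_toReal _ _)
      (measurable_rpow_mul_perspectiveIntegral hm _).aestronglyMeasurable,
    lintegral_ofReal_rpow_mul_perspectiveIntegral hm h0 hint hp, ENNReal.toReal_mul,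
    ENNReal.toReal_ofReal (Gamma_pos_of_pos hp).le,
    integral_eq_lintegral_of_nonneg_ae (.of_forall fun x => rpow_nonneg (h0 x) p)
      (hm.pow_const p).aestronglyMeasurable]

theorem concaveOn_log_perspectiveIntegral (hm : Measurable f) (hint : Integrable f)
    (hf : ConvexOn ℝ {x | 0 < f x} fun x => (f x)⁻¹) (hvol : volume {x | 0 < f x} ≠ 0) :
    ConcaveOn ℝ (Set.Ioi 0) fun t => log (perspectiveIntegral f t).toReal := by
  have hpos : ∀ t, 0 < t → 0 < (perspectiveIntegral f t).toReal := fun t ht =>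
    ENNReal.toReal_pos (perspectiveIntegral_ne_zero hm hvol ht) (perspectiveIntegral_ne_top hint ht)
  refine LinearOrder.concaveOn_of_lt (convex_Ioi 0) ?_
  intro s (hs : 0 < s) t (ht : 0 < t) _ a b ha hb hab
  have hr : 0 < a * s + b * t := by positivity
  have h := ENNReal.toReal_mono (perspectiveIntegral_ne_top hint hr)
    (perspectiveIntegral_rpow_mul_le hm hf hs ht ha hb hab)
  rw [ENNReal.toReal_mul, ← ENNReal.toReal_rpow, ← ENNReal.toReal_rpow] at h
  have hs' := rpow_pos_of_pos (hpos s hs) a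
  have ht' := rpow_pos_of_pos (hpos t ht) b
  have h2 := log_le_log (mul_pos hs' ht') h
  rwa [log_mul hs'.ne' ht'.ne', log_rpow (hpos s hs), log_rpow (hpos t ht)] at h2

theorem concaveOn_log_prod_mul_integral_rpow_of_measurable (hm : Measurable f)
    (h0 : ∀ x, 0 ≤ f x) (hint : Integrable f)
    (hf : ConvexOn ℝ {x | 0 < f x} fun x => (f x)⁻¹) :
    ConcaveOn ℝ (Set.Ioi (n : ℝ)) fun p =>
      log ((∏ i ∈ Finset.range (n + 1), (p - (i : ℝ))) * ∫ x, f x ^ p) := by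
  have hzero : (∀ p : ℝ, n < p → ∫ x, f x ^ p = 0) → ConcaveOn ℝ (Set.Ioi (n : ℝ)) fun p =>
      log ((∏ i ∈ Finset.range (n + 1), (p - (i : ℝ))) * ∫ x, f x ^ p) := fun h =>
    (concaveOn_const 0 (convex_Ioi _)).congr fun p hp => by simp [h p hp]
  have hp0 : ∀ p : ℝ, n < p → 0 < p := fun p hp => (Nat.cast_nonneg n).trans_lt hp
  by_cases hvol : volume {x | 0 < f x} = 0
  · refine hzero fun p hp => integral_eq_zero_of_ae ?_
    have hae : ∀ᵐ x, ¬ 0 < f x := by simpa [ae_iff] using hvol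
    filter_upwards [hae] with x hx
    rw [le_antisymm (not_lt.1 hx) (h0 x), zero_rpow (hp0 p hp).ne', Pi.zero_apply]
  by_cases hex : ∃ p : ℝ, n < p ∧ Integrable fun x => f x ^ p
  swap
  · push Not at hex
    exact hzero fun p hp => integral_undef (hex p hp)
  obtain ⟨p₀, hnp₀, hp₀⟩ := hex
  set φ : ℝ → ℝ := fun t => (perspectiveIntegral f t).toReal
  have hpos : ∀ t, 0 < t → 0 < φ t := fun t ht =>
    ENNReal.toReal_pos (perspectiveIntegral_ne_zero hm hvol ht) (perspectiveIntegral_ne_top hint ht)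
  have hconc := concaveOn_log_perspectiveIntegral hm hint hf hvol
  rw [integrable_rpow_iff_integrableOn_perspectiveIntegral hm h0 hint (hp0 _ hnp₀)] at hp₀
  have hφ : ∀ q : ℝ, 0 < q → IntegrableOn (fun t => t ^ (q - 1) * φ t) (Set.Ioi 0) := fun q hq =>
    integrableOn_rpow_mul_of_logConcave hpos hconc (sub_pos.2 hnp₀) hp₀ hq
  have hM : ConcaveOn ℝ (Set.Ioi (n : ℝ)) fun p =>
      log ((∫ t in Set.Ioi 0, t ^ (p - n - 1) * φ t) / Gamma (p - n)) := by
    have := (concaveOn_log_mellin_div_Gamma hpos hconc hφ).translate_left (-(n : ℝ))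
    convert! this using 1
    ext p
    simp
  have hlog : ConcaveOn ℝ (Set.Ioi (n : ℝ)) log := strictConcaveOn_log_Ioi.concaveOn.subset
    (Set.Ioi_subset_Ioi (Nat.cast_nonneg n)) (convex_Ioi _)
  refine (hlog.add hM).congr fun p (hp : n < p) => ?_
  have hG := Gamma_pos_of_pos (sub_pos.2 hp)
  have hJ := setIntegral_rpow_mul_pos hpos (hφ (p - n) (sub_pos.2 hp))
  have hprod := prod_range_sub_mul_Gamma (n + 1) (p := p) (by push_cast; linarith)
  rw [Gamma_add_one (hp0 p hp).ne'] at hprod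
  push_cast at hprod
  rw [show p - (n + 1) + 1 = p - (n : ℝ) by ring, ← eq_div_iff hG.ne'] at hprod
  rw [Pi.add_apply, ← log_mul (hp0 p hp).ne' (div_pos hJ hG).ne', hprod,
    setIntegral_rpow_mul_perspectiveIntegral hm h0 hint (hp0 p hp)]
  congr 1
  ring

end

/-- If `f : ℝⁿ → [0,∞)` is integrable and `(-1)`-concave (i.e. `1/f` is convex
on the support of `f`), then `p ↦ p(p-1)⋯(p-n) ∫ f^p` is log-concave for `p > n`. -/
theorem stmt8
    (n : ℕ) (f : (Fin n → ℝ) → ℝ)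
    (hf_nonneg : ∀ x, 0 ≤ f x)
    (hf_int : Integrable f)
    (hf_conv : ConvexOn ℝ {x | 0 < f x} (fun x => (f x)⁻¹)) :
    ConcaveOn ℝ (Set.Ioi (n : ℝ))
      (fun p => Real.log
        ((∏ i ∈ Finset.range (n + 1), (p - (i : ℝ))) * ∫ x, f x ^ p)) := by
  set U := interior {x | 0 < f x} with hU
  have hUsub : U ⊆ {x | 0 < f x} := interior_subset
  have hUo : IsOpen U := isOpen_interior
  set g := U.indicator f with hg
  have hconvU : ConvexOn ℝ U fun x => (f x)⁻¹ := hf_conv.subset hUsub hf_conv.1.interior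
  have hgpos : {x | 0 < g x} = U := by
    ext x
    by_cases hx : x ∈ U
    · simpa [hg, hx] using hUsub hx
    · simp [hg, hx]
  have hcont : ContinuousOn f U := by
    refine ((hconvU.continuousOn hUo).inv₀ fun x hx => ?_).congr fun x hx => (inv_inv _).symm
    exact inv_ne_zero (hUsub hx).ne'
  have hgm : Measurable g := by
    classical
    rw [hg, ← Set.piecewise_eq_indicator]
    exact hcont.measurable_piecewise continuousOn_const hUo.measurableSet
  have hfg : g =ᵐ[volume] f := by
    have hnull := hf_conv.1.addHaar_frontier volume
    filter_upwards [measure_eq_zero_iff_ae_notMem.1 hnull] with x hx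
    by_cases hxU : x ∈ U
    · simp [hg, hxU]
    · have : ¬ 0 < f x := fun h => hx ⟨subset_closure h, hxU⟩
      simp [hg, hxU, le_antisymm (not_lt.1 this) (hf_nonneg x)]
  have key := concaveOn_log_prod_mul_integral_rpow_of_measurable hgm
    (fun x => Set.indicator_nonneg (fun x _ => hf_nonneg x) x) (hf_int.congr hfg.symm) (by
      rw [hgpos]
      exact hconvU.congr fun x hx => by simp [hg, hx])
  refine key.congr fun p _ => ?_
  have : ∫ x, g x ^ p = ∫ x, f x ^ p := integral_congr_ae (hfg.mono fun x hx => by simp only [hx])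
  simp only [this]
end

section
/- Let β > n and let X be a random vector in ℝⁿ with (-1/β)-concave density f. Then the varentropy satisfies Var(-log f(X)) ≤ β² ∑_{i=1}^n (β - i)^{-2}, with equality for the Pareto distribution with density f(x) = Z⁻¹ (a + x₁ + ⋯ + xₙ)^{-β} on the positive orthant. -/
open MeasureTheory ProbabilityTheory Real
open scoped ENNReal Pointwise

lemma volume_add_volume_le_of_isCompact {K L : Set ℝ} (hK : IsCompact K) (hL : IsCompact L)
    (hK' : K.Nonempty) (hL' : L.Nonempty) : volume K + volume L ≤ volume (K + L) := by
  obtain ⟨k, hkK, hk⟩ := hK.exists_isGreatest hK'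
  obtain ⟨l, hlL, hl⟩ := hL.exists_isLeast hL'
  have h1 : volume ((fun x => x + l) '' K) = volume K := by
    simp [Set.image_add_right]
  have h2 : volume ((fun x => k + x) '' L) = volume L := by
    simp [Set.image_add_left]
  have hdisj : AEDisjoint volume ((fun x => x + l) '' K) ((fun x => k + x) '' L) := by
    refine measure_mono_null (t := {k + l}) ?_ (by simp)
    rintro _ ⟨⟨x, hx, rfl⟩, ⟨y, hy, hxy⟩⟩
    have := hk hx
    have := hl hy
    simp only at hxy
    simp only [Set.mem_singleton_iff]
    linarith
  rw [← h1, ← h2, ← measure_union₀ _ hdisj]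
  · refine measure_mono (Set.union_subset ?_ ?_)
    · rintro _ ⟨x, hx, rfl⟩
      exact Set.add_mem_add hx hlL
    · rintro _ ⟨x, hx, rfl⟩
      exact Set.add_mem_add hkK hx
  · exact (hL.image (by fun_prop)).measurableSet.nullMeasurableSet

/-- The one-dimensional Brunn–Minkowski inequality. -/
lemma volume_add_volume_le {A B : Set ℝ} (hA : MeasurableSet A) (hB : MeasurableSet B)
    (hA' : A.Nonempty) (hB' : B.Nonempty) : volume A + volume B ≤ volume (A + B) := by
  obtain ⟨a, ha⟩ := hA'
  obtain ⟨b, hb⟩ := hB'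
  rw [hA.measure_eq_iSup_isCompact, hB.measure_eq_iSup_isCompact]
  simp only [iSup_and']
  refine ENNReal.biSup_add_biSup_le' (p := fun K => K ⊆ A ∧ IsCompact K)
    (q := fun K => K ⊆ B ∧ IsCompact K) ⟨∅, by simp⟩ ⟨∅, by simp⟩ ?_
  rintro K ⟨hKA, hK⟩ L ⟨hLB, hL⟩
  calc volume K + volume L ≤ volume (insert a K) + volume (insert b L) := by
        gcongr <;> exact Set.subset_insert _ _
    _ ≤ volume (insert a K + insert b L) :=
        volume_add_volume_le_of_isCompact (hK.insert a) (hL.insert b) (Set.insert_nonempty _ _)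
          (Set.insert_nonempty _ _)
    _ ≤ volume (A + B) := by
        gcongr <;> exact Set.insert_subset ‹_› ‹_›

lemma lintegral_eq_lintegral_Ioo_measure_lt {f : ℝ → ℝ≥0∞} (hf : Measurable f)
    (hf1 : ∀ x, f x ≤ 1) :
    ∫⁻ x, f x = ∫⁻ t in Set.Ioo (0 : ℝ) 1, volume {x | ENNReal.ofReal t < f x} := by
  have hfin : ∀ x, f x ≠ ∞ := fun x => ne_top_of_le_ne_top ENNReal.one_ne_top (hf1 x)
  have h := lintegral_eq_lintegral_meas_lt volume (f := fun x => (f x).toReal)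
    (Filter.Eventually.of_forall fun x => ENNReal.toReal_nonneg) hf.ennreal_toReal.aemeasurable
  simp only [ENNReal.ofReal_toReal (hfin _)] at h
  rw [h, ← Set.Ioo_union_Ici_eq_Ioi (zero_lt_one' ℝ), lintegral_union measurableSet_Ici]
  · have h0 : ∫⁻ t in Set.Ici (1 : ℝ), volume {x | t < (f x).toReal} = 0 := by
      rw [setLIntegral_congr_fun (g := fun _ => 0) measurableSet_Ici]
      · simp
      · intro t ht
        have : {x | t < (f x).toReal} = ∅ := by
          ext x
          simp only [Set.mem_ofPred_eq, Set.mem_empty_iff_false, iff_false, not_lt]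
          exact (ENNReal.toReal_mono ENNReal.one_ne_top (hf1 x)).trans (by simpa using ht)
        simp [this]
    rw [h0, add_zero]
    refine setLIntegral_congr_fun measurableSet_Ioo fun t ht => ?_
    congr 1
    ext x
    exact (ENNReal.ofReal_lt_iff_lt_toReal ht.1.le (hfin x)).symm
  · rw [Set.disjoint_left]
    intro x hx hx'
    exact absurd hx.2 (not_lt.2 hx')

lemma lintegral_prekopa_leindler_of_iSup_eq_one {f g h : ℝ → ℝ≥0∞} (hf : Measurable f)
    (hg : Measurable g) (hh : Measurable h) {a b : ℝ} (ha : 0 < a) (hb : 0 < b) (hab : a + b = 1)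
    (hf1 : ⨆ x, f x = 1) (hg1 : ⨆ x, g x = 1)
    (H : ∀ x y, f x ^ a * g y ^ b ≤ h (a * x + b * y)) :
    ENNReal.ofReal a * (∫⁻ x, f x) + ENNReal.ofReal b * (∫⁻ x, g x) ≤ ∫⁻ x, h x := by
  have hf1' : ∀ x, f x ≤ 1 := fun x => hf1 ▸ le_iSup f x
  have hg1' : ∀ x, g x ≤ 1 := fun x => hg1 ▸ le_iSup g x
  have hmin : Measurable fun x => min (h x) 1 := hh.min measurable_const
  refine le_trans ?_ (lintegral_mono (fun x => min_le_left (h x) 1))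
  rw [lintegral_eq_lintegral_Ioo_measure_lt hf hf1', lintegral_eq_lintegral_Ioo_measure_lt hg hg1',
    lintegral_eq_lintegral_Ioo_measure_lt hmin (fun x => min_le_right _ _),
    ← lintegral_const_mul' _ _ ENNReal.ofReal_ne_top,
    ← lintegral_const_mul' _ _ ENNReal.ofReal_ne_top]
  have hanti : Antitone fun t : ℝ => ENNReal.ofReal a * volume {x | ENNReal.ofReal t < f x} := by
    intro s t hst
    dsimp only
    gcongr with x
  rw [← lintegral_add_left hanti.measurable]
  refine setLIntegral_mono' measurableSet_Ioo fun t ht => ?_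
  have ht1 : ENNReal.ofReal t < 1 := by simpa using ht.2
  have hf' : {x | ENNReal.ofReal t < f x}.Nonempty := by
    obtain ⟨x, hx⟩ := lt_iSup_iff.1 (ht1.trans_eq hf1.symm)
    exact ⟨x, hx⟩
  have hg' : {x | ENNReal.ofReal t < g x}.Nonempty := by
    obtain ⟨x, hx⟩ := lt_iSup_iff.1 (ht1.trans_eq hg1.symm)
    exact ⟨x, hx⟩
  have key := volume_add_volume_le (A := a • {x | ENNReal.ofReal t < f x})
    (B := b • {x | ENNReal.ofReal t < g x})
    ((measurableSet_lt measurable_const hf).const_smul_of_ne_zero ha.ne')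
    ((measurableSet_lt measurable_const hg).const_smul_of_ne_zero hb.ne')
    (Set.Nonempty.smul_set hf')
    (Set.Nonempty.smul_set hg')
  rw [Measure.addHaar_smul_of_nonneg _ ha.le, Measure.addHaar_smul_of_nonneg _ hb.le] at key
  simp only [Module.finrank_self, pow_one] at key
  refine key.trans (measure_mono ?_)
  rintro _ ⟨_, ⟨x, hx, rfl⟩, _, ⟨y, hy, rfl⟩, rfl⟩
  simp only [Set.mem_ofPred_eq, smul_eq_mul, lt_min_iff] at hx hy ⊢
  refine ⟨lt_of_lt_of_le ?_ (H x y), ht1⟩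
  have ht0 : ENNReal.ofReal t ≠ 0 := by simpa using ht.1
  calc ENNReal.ofReal t = ENNReal.ofReal t ^ a * ENNReal.ofReal t ^ b := by
        rw [← ENNReal.rpow_add _ _ ht0 ENNReal.ofReal_ne_top, hab, ENNReal.rpow_one]
    _ < f x ^ a * g y ^ b :=
        ENNReal.mul_lt_mul (ENNReal.rpow_lt_rpow hx ha) (ENNReal.rpow_lt_rpow hy hb)

lemma ENNReal.rpow_mul_rpow_le_add {a b : ℝ} (ha : 0 < a) (hb : 0 < b) (hab : a + b = 1)
    (x y : ℝ≥0∞) : x ^ a * y ^ b ≤ ENNReal.ofReal a * x + ENNReal.ofReal b * y := by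
  have hpq : (a⁻¹).HolderConjugate b⁻¹ := by
    rw [Real.holderConjugate_iff]
    refine ⟨(one_lt_inv₀ ha).2 (by linarith), by simpa using hab⟩
  have h := ENNReal.young_inequality (x ^ a) (y ^ b) hpq
  rw [← ENNReal.rpow_mul, ← ENNReal.rpow_mul, mul_inv_cancel₀ ha.ne', mul_inv_cancel₀ hb.ne',
    ENNReal.rpow_one, ENNReal.rpow_one, ENNReal.ofReal_inv_of_pos ha, ENNReal.ofReal_inv_of_pos hb,
    div_eq_mul_inv, div_eq_mul_inv, inv_inv, inv_inv, mul_comm x, mul_comm y] at h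
  exact h

lemma lintegral_prekopa_leindler_of_iSup_ne_top {f g h : ℝ → ℝ≥0∞} (hf : Measurable f)
    (hg : Measurable g) (hh : Measurable h) {a b : ℝ} (ha : 0 < a) (hb : 0 < b) (hab : a + b = 1)
    (hf1 : ⨆ x, f x ≠ ∞) (hg1 : ⨆ x, g x ≠ ∞)
    (H : ∀ x y, f x ^ a * g y ^ b ≤ h (a * x + b * y)) :
    (∫⁻ x, f x) ^ a * (∫⁻ x, g x) ^ b ≤ ∫⁻ x, h x := by
  set F := ⨆ x, f x with hF
  set G := ⨆ x, g x with hG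
  rcases eq_or_ne F 0 with hF0 | hF0
  · have : ∀ x, f x = 0 := by simpa [hF] using hF0
    simp [this, ha]
  rcases eq_or_ne G 0 with hG0 | hG0
  · have : ∀ x, g x = 0 := by simpa [hG] using hG0
    simp [this, hb]
  have hFa0 : F ^ a ≠ 0 := by simp [hF0, hf1]
  have hGb0 : G ^ b ≠ 0 := by simp [hG0, hg1]
  have hFa : F ^ a ≠ ∞ := by simp [hf1, hF0]
  have hGb : G ^ b ≠ ∞ := by simp [hg1, hG0]
  have key := lintegral_prekopa_leindler_of_iSup_eq_one (f := fun x => F⁻¹ * f x)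
    (g := fun x => G⁻¹ * g x) (h := fun x => (F ^ a)⁻¹ * (G ^ b)⁻¹ * h x) (by fun_prop)
    (by fun_prop) (by fun_prop) ha hb hab
    (by rw [← ENNReal.mul_iSup, ENNReal.inv_mul_cancel hF0 hf1])
    (by rw [← ENNReal.mul_iSup, ENNReal.inv_mul_cancel hG0 hg1])
    (by
      intro x y
      rw [ENNReal.mul_rpow_of_nonneg _ _ ha.le, ENNReal.mul_rpow_of_nonneg _ _ hb.le,
        ENNReal.inv_rpow, ENNReal.inv_rpow, mul_mul_mul_comm]
      gcongr
      exact H x y)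
  replace key := (ENNReal.rpow_mul_rpow_le_add ha hb hab _ _).trans key
  rw [lintegral_const_mul _ hf, lintegral_const_mul _ hg, lintegral_const_mul _ hh,
    ENNReal.mul_rpow_of_nonneg _ _ ha.le, ENNReal.mul_rpow_of_nonneg _ _ hb.le,
    ENNReal.inv_rpow, ENNReal.inv_rpow, mul_mul_mul_comm] at key
  refine (ENNReal.mul_le_mul_iff_right ?_ ?_).1 key
  · exact mul_ne_zero (ENNReal.inv_ne_zero.2 hFa) (ENNReal.inv_ne_zero.2 hGb)
  · exact ENNReal.mul_ne_top (ENNReal.inv_ne_top.2 hFa0) (ENNReal.inv_ne_top.2 hGb0)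

lemma rpow_lintegral_eq_iSup_min {f : ℝ → ℝ≥0∞} (hf : Measurable f) {a : ℝ} (ha : 0 < a) :
    (∫⁻ x, f x) ^ a = ⨆ N : ℕ, (∫⁻ x, min (f x) N) ^ a := by
  have h : ∫⁻ x, f x = ⨆ N : ℕ, ∫⁻ x, min (f x) N := by
    rw [← lintegral_iSup (fun N => by fun_prop)]
    · refine lintegral_congr fun x => ?_
      rw [← inf_iSup_eq, ENNReal.iSup_natCast, inf_top_eq]
    · intro M N hMN x
      dsimp only
      gcongr
  rw [h, ← ENNReal.orderIsoRpow_apply a ha, OrderIso.map_iSup]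
  rfl

/-- The one-dimensional Prékopa–Leindler inequality. -/
theorem lintegral_prekopa_leindler_real {f g h : ℝ → ℝ≥0∞} (hf : Measurable f)
    (hg : Measurable g) (hh : Measurable h) {a b : ℝ} (ha : 0 < a) (hb : 0 < b) (hab : a + b = 1)
    (H : ∀ x y, f x ^ a * g y ^ b ≤ h (a * x + b * y)) :
    (∫⁻ x, f x) ^ a * (∫⁻ x, g x) ^ b ≤ ∫⁻ x, h x := by
  rw [rpow_lintegral_eq_iSup_min hf ha, rpow_lintegral_eq_iSup_min hg hb, ENNReal.iSup_mul]
  refine iSup_le fun M => ?_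
  rw [ENNReal.mul_iSup]
  refine iSup_le fun N => ?_
  have hbdd : ∀ (u : ℝ → ℝ≥0∞) (k : ℕ), ⨆ x, min (u x) k ≠ ∞ := fun u k =>
    ne_top_of_le_ne_top (ENNReal.natCast_ne_top k) (iSup_le fun x => min_le_right _ _)
  refine lintegral_prekopa_leindler_of_iSup_ne_top (by fun_prop) (by fun_prop) hh ha hb hab
    (hbdd f M) (hbdd g N) fun x y => le_trans ?_ (H x y)
  gcongr <;> exact min_le_left _ _

lemma lintegral_fin_succ {n : ℕ} {f : (Fin (n + 1) → ℝ) → ℝ≥0∞} (hf : Measurable f) :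
    ∫⁻ x, f x = ∫⁻ t : ℝ, ∫⁻ x : Fin n → ℝ, f (Fin.cons t x) := by
  have h := (volume_preserving_piFinSuccAbove (fun _ : Fin (n + 1) => ℝ) 0).symm
  rw [← h.lintegral_comp hf, Measure.volume_eq_prod, lintegral_prod]
  · simp [MeasurableEquiv.piFinSuccAbove, Fin.insertNthEquiv]
  · exact (hf.comp (MeasurableEquiv.measurable _)).aemeasurable

/-- The Prékopa–Leindler inequality. -/
theorem lintegral_prekopa_leindler {n : ℕ} {f g h : (Fin n → ℝ) → ℝ≥0∞} (hf : Measurable f)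
    (hg : Measurable g) (hh : Measurable h) {a b : ℝ} (ha : 0 < a) (hb : 0 < b) (hab : a + b = 1)
    (H : ∀ x y, f x ^ a * g y ^ b ≤ h (a • x + b • y)) :
    (∫⁻ x, f x) ^ a * (∫⁻ x, g x) ^ b ≤ ∫⁻ x, h x := by
  induction n with
  | zero =>
    have hv : (volume : Measure (Fin 0 → ℝ)) = Measure.dirac default := by
      rw [volume_pi, Measure.pi_of_empty]
      congr 1
      exact Subsingleton.elim _ _
    simp only [hv, lintegral_dirac]
    convert H default default
  | succ n ih =>
    have hc : Measurable fun p : ℝ × (Fin n → ℝ) => (Fin.cons p.1 p.2 : Fin (n + 1) → ℝ) := by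
      refine measurable_pi_lambda _ fun i => ?_
      refine Fin.cases ?_ (fun j => ?_) i
      · simpa using measurable_fst
      · simp only [Fin.cons_succ]
        fun_prop
    have hm : ∀ u : (Fin (n + 1) → ℝ) → ℝ≥0∞, Measurable u →
        Measurable fun t : ℝ => ∫⁻ x : Fin n → ℝ, u (Fin.cons t x) := fun u hu =>
      Measurable.lintegral_prod_right (hu.comp hc)
    rw [lintegral_fin_succ hf, lintegral_fin_succ hg, lintegral_fin_succ hh]
    refine lintegral_prekopa_leindler_real (hm f hf) (hm g hg) (hm h hh) ha hb hab fun s t => ?_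
    refine ih (hf.comp (hc.comp measurable_prodMk_left)) (hg.comp (hc.comp measurable_prodMk_left))
      (hh.comp (hc.comp measurable_prodMk_left)) fun x y => ?_
    refine (H _ _).trans (le_of_eq ?_)
    congr 1
    ext i
    refine Fin.cases ?_ (fun j => ?_) i <;> simp

/-- The multiplicative form of the Brunn–Minkowski inequality. -/
lemma volume_rpow_mul_volume_rpow_le {n : ℕ} {A B C : Set (Fin n → ℝ)} (hA : MeasurableSet A)
    (hB : MeasurableSet B) (hC : MeasurableSet C) {a b : ℝ} (ha : 0 < a) (hb : 0 < b)
    (hab : a + b = 1) (H : ∀ x ∈ A, ∀ y ∈ B, a • x + b • y ∈ C) :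
    volume A ^ a * volume B ^ b ≤ volume C := by
  rw [← lintegral_indicator_one hA, ← lintegral_indicator_one hB, ← lintegral_indicator_one hC]
  refine lintegral_prekopa_leindler (by fun_prop (disch := assumption))
    (by fun_prop (disch := assumption)) (by fun_prop (disch := assumption)) ha hb hab
    fun x y => ?_
  by_cases hx : x ∈ A
  · by_cases hy : y ∈ B
    · simp [hx, hy, H x hx y hy]
    · simp [hy, hb]
  · simp [hx, ha]

/-- The Brunn–Minkowski inequality, for sets whose volumes are given as `n`-th powers. -/
theorem ofReal_pow_le_volume {n : ℕ} {A B C : Set (Fin n → ℝ)} (hA : MeasurableSet A)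
    (hB : MeasurableSet B) (hC : MeasurableSet C) {a b r s : ℝ} (ha : 0 < a) (hb : 0 < b)
    (hr : 0 < r) (hs : 0 < s) (hAr : volume A = ENNReal.ofReal (r ^ n))
    (hBs : volume B = ENNReal.ofReal (s ^ n)) (H : ∀ x ∈ A, ∀ y ∈ B, a • x + b • y ∈ C) :
    ENNReal.ofReal ((a * r + b * s) ^ n) ≤ volume C := by
  set R := a * r + b * s with hR
  have hRpos : 0 < R := by positivity
  have hvol : ∀ (D : Set (Fin n → ℝ)) (q : ℝ), 0 < q →
      volume (q⁻¹ • D) = ENNReal.ofReal ((q ^ n)⁻¹) * volume D := by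
    intro D q hq
    rw [Measure.addHaar_smul_of_nonneg _ (by positivity)]
    simp
  have key := volume_rpow_mul_volume_rpow_le (A := r⁻¹ • A) (B := s⁻¹ • B) (C := R⁻¹ • C)
    (hA.const_smul_of_ne_zero (by positivity)) (hB.const_smul_of_ne_zero (by positivity))
    (hC.const_smul_of_ne_zero (by positivity)) (a := a * r / R) (b := b * s / R)
    (by positivity) (by positivity) (by rw [← add_div, ← hR, div_self hRpos.ne'])
    (by
      rintro _ ⟨x, hx, rfl⟩ _ ⟨y, hy, rfl⟩
      refine ⟨_, H x hx y hy, ?_⟩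
      simp only [smul_add, smul_smul]
      congr 2 <;> field_simp)
  have hone : ∀ q : ℝ, 0 < q →
      ENNReal.ofReal ((q ^ n)⁻¹) * ENNReal.ofReal (q ^ n) = 1 := by
    intro q hq
    rw [← ENNReal.ofReal_mul (by positivity), inv_mul_cancel₀ (by positivity), ENNReal.ofReal_one]
  rw [hvol A r hr, hvol B s hs, hvol C R hRpos, hAr, hBs, hone r hr, hone s hs] at key
  simp only [ENNReal.one_rpow, mul_one] at key
  calc ENNReal.ofReal (R ^ n) = ENNReal.ofReal (R ^ n) * 1 := (mul_one _).symm
    _ ≤ ENNReal.ofReal (R ^ n) * (ENNReal.ofReal ((R ^ n)⁻¹) * volume C) := by gcongr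
    _ = volume C := by rw [← mul_assoc, mul_comm (ENNReal.ofReal _), hone R hRpos, one_mul]

lemma integrable_withDensity_ofReal_iff {w : ℝ → ℝ} (hw : Measurable w) (hw0 : ∀ x, 0 ≤ w x)
    (g : ℝ → ℝ) :
    Integrable g (volume.withDensity fun x => ENNReal.ofReal (w x)) ↔
      Integrable fun x => w x * g x := by
  rw [integrable_withDensity_iff_integrable_smul' (by fun_prop) (by simp)]
  simp [ENNReal.toReal_ofReal (hw0 _)]

lemma integral_withDensity_ofReal {w : ℝ → ℝ} (hw : Measurable w) (hw0 : ∀ x, 0 ≤ w x)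
    (g : ℝ → ℝ) :
    ∫ x, g x ∂(volume.withDensity fun x => ENNReal.ofReal (w x)) = ∫ x, w x * g x := by
  rw [integral_withDensity_eq_integral_toReal_smul (by fun_prop) (by simp)]
  simp [ENNReal.toReal_ofReal (hw0 _)]

lemma expMeasure_eq_withDensity (r : ℝ) :
    expMeasure r = volume.withDensity fun x => ENNReal.ofReal (exponentialPDFReal r x) := rfl

lemma exponentialPDFReal_mul_pow (r : ℝ) (k : ℕ) :
    (fun x => exponentialPDFReal r x * x ^ k) =ᵐ[volume]
      (Set.Ioi 0).indicator fun x => r * (x ^ (((k : ℝ) + 1) - 1) * exp (-(r * x))) := by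
  have h0 : ∀ᵐ x : ℝ, x ≠ 0 := by simp [ae_iff]
  filter_upwards [h0] with x hx
  rcases lt_or_gt_of_ne hx with h | h
  · simp [exponentialPDFReal, gammaPDFReal, h.not_ge, h.le]
  · simp [exponentialPDFReal, gammaPDFReal, h.le, h]
    ring

lemma integral_pow_expMeasure {r : ℝ} (hr : 0 < r) (k : ℕ) :
    ∫ x, x ^ k ∂(expMeasure r) = k.factorial / r ^ k := by
  rw [expMeasure_eq_withDensity, integral_withDensity_ofReal (measurable_exponentialPDFReal r)
    (exponentialPDFReal_nonneg hr), integral_congr_ae (exponentialPDFReal_mul_pow r k),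
    integral_indicator measurableSet_Ioi, integral_const_mul,
    Real.integral_rpow_mul_exp_neg_mul_Ioi (by positivity) hr, Real.Gamma_nat_eq_factorial,
    Real.rpow_add_one (by positivity), Real.rpow_natCast, one_div, inv_pow]
  field_simp

lemma integrable_pow_expMeasure {r : ℝ} (hr : 0 < r) (k : ℕ) :
    Integrable (fun x => x ^ k) (expMeasure r) := by
  rw [expMeasure_eq_withDensity, integrable_withDensity_ofReal_iff
    (measurable_exponentialPDFReal r) (exponentialPDFReal_nonneg hr),
    integrable_congr (exponentialPDFReal_mul_pow r k), integrable_indicator_iff measurableSet_Ioi]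
  refine Integrable.const_mul ?_ r
  have h := integrableOn_rpow_mul_exp_neg_mul_rpow (p := 1) (s := (k : ℝ) + 1 - 1) (b := r)
    (by have : (0 : ℝ) ≤ k := by positivity
        linarith) one_pos hr
  simpa [IntegrableOn] using h

lemma memLp_id_expMeasure {r : ℝ} (hr : 0 < r) : MemLp id 2 (expMeasure r) :=
  (memLp_two_iff_integrable_sq aestronglyMeasurable_id).2 (integrable_pow_expMeasure hr 2)

lemma variance_id_expMeasure {r : ℝ} (hr : 0 < r) : Var[id; expMeasure r] = r⁻¹ ^ 2 := by
  have := isProbabilityMeasure_expMeasure hr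
  have h1 := integral_pow_expMeasure hr 1
  have h2 := integral_pow_expMeasure hr 2
  rw [variance_eq_sub (memLp_id_expMeasure hr)]
  simp only [Pi.pow_apply, id, pow_one] at h1 h2 ⊢
  rw [h1, h2]
  simp [Nat.factorial]
  field_simp
  norm_num

lemma memLp_id_conv_expMeasure_iff {P : Measure ℝ} [IsProbabilityMeasure P] {r : ℝ} (hr : 0 < r) :
    MemLp id 2 (P ∗ expMeasure r) ↔ MemLp id 2 P := by
  have := isProbabilityMeasure_expMeasure hr
  have hE : MemLp (fun p : ℝ × ℝ => p.2) 2 (P.prod (expMeasure r)) :=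
    (memLp_id_expMeasure hr).comp_snd P
  rw [Measure.conv, memLp_map_measure_iff aestronglyMeasurable_id (by fun_prop)]
  constructor
  · intro h
    have h' : MemLp (fun p : ℝ × ℝ => id p.1) 2 (P.prod (expMeasure r)) := by
      convert h.sub hE using 1
      ext p
      simp
    rwa [← (measurePreserving_fst (μ := P) (ν := expMeasure r)).map_eq,
      memLp_map_measure_iff aestronglyMeasurable_id (by fun_prop)]
  · intro h
    exact (h.comp_fst (expMeasure r)).add hE

lemma variance_id_conv_expMeasure {P : Measure ℝ} [IsProbabilityMeasure P] {r : ℝ} (hr : 0 < r)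
    (hP : MemLp id 2 P) : Var[id; P ∗ expMeasure r] = Var[id; P] + r⁻¹ ^ 2 := by
  have := isProbabilityMeasure_expMeasure hr
  rw [← variance_id_expMeasure hr, ← variance_add_prod hP (memLp_id_expMeasure hr)]
  exact variance_id_map (X := fun p : ℝ × ℝ => p.1 + p.2) (by fun_prop)

/-- Convolving a measure with density `exp (-r u)` with respect to `ρ` with the exponential
distribution of rate `r` gives a measure with density `r exp (-r w) ρ((-∞, w])`. -/
lemma withDensity_exp_conv_expMeasure (ρ : Measure ℝ) [SFinite ρ] {r : ℝ} (hr : 0 < r) :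
    (ρ.withDensity fun u => ENNReal.ofReal (exp (-(r * u)))) ∗ expMeasure r =
      volume.withDensity fun w => ENNReal.ofReal (r * exp (-(r * w))) * ρ (Set.Iic w) := by
  have := isProbabilityMeasure_expMeasure hr
  have hmeas : Measurable fun w => ρ (Set.Iic w) :=
    Monotone.measurable fun s t hst => measure_mono (Set.Iic_subset_Iic.2 hst)
  have hdens : Measurable fun w => ENNReal.ofReal (r * exp (-(r * w))) * ρ (Set.Iic w) :=
    Measurable.mul (by fun_prop) hmeas
  refine Measure.ext_of_lintegral _ fun g hg => ?_
  have hpdf : Measurable fun x => exponentialPDFReal r x := measurable_exponentialPDFReal r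
  have hin : ∀ u : ℝ, ENNReal.ofReal (exp (-(r * u))) * ∫⁻ t, g (u + t) ∂(expMeasure r) =
      ∫⁻ w, ENNReal.ofReal (r * exp (-(r * w))) * g w * (Set.Iic w).indicator 1 u := by
    intro u
    rw [expMeasure_eq_withDensity, lintegral_withDensity_eq_lintegral_mul _ (by fun_prop)
      (by fun_prop), ← lintegral_const_mul _ (by fun_prop), ← lintegral_add_left_eq_self
        (fun w => ENNReal.ofReal (r * exp (-(r * w))) * g w * (Set.Iic w).indicator 1 u) u]
    refine lintegral_congr fun t => ?_
    by_cases ht : 0 ≤ t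
    · simp only [Pi.mul_apply, exponentialPDFReal, gammaPDFReal, ht, if_true, Set.mem_Iic,
        le_add_iff_nonneg_right, Set.indicator_of_mem, Pi.one_apply, mul_one, ← mul_assoc]
      rw [← ENNReal.ofReal_mul (by positivity)]
      congr 2
      rw [mul_add, neg_add, exp_add]
      simp
      ring
    · simp [exponentialPDFReal, gammaPDFReal, ht]
  rw [Measure.lintegral_conv hg, lintegral_withDensity_eq_lintegral_mul _ (by fun_prop)
    (by fun_prop), lintegral_withDensity_eq_lintegral_mul _ hdens hg]
  simp only [Pi.mul_apply, hin]
  rw [lintegral_lintegral_swap]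
  · refine lintegral_congr fun w => ?_
    rw [lintegral_const_mul _ (by fun_prop (disch := measurability)),
      lintegral_indicator_one measurableSet_Iic]
    ring
  · refine Measurable.aemeasurable ?_
    refine Measurable.mul (by fun_prop) ?_
    have hs : MeasurableSet {p : ℝ × ℝ | p.1 ≤ p.2} := measurableSet_le measurable_fst measurable_snd
    exact (measurable_one.indicator hs)

/-- The law of a sum of independent exponential variables with rates `β - n, …, β - 1, β`. -/
noncomputable def expSumMeasure : ℕ → ℝ → Measure ℝ
  | 0, β => expMeasure β
  | n + 1, β => expSumMeasure n (β - 1) ∗ expMeasure β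

lemma expSumMeasure_spec (n : ℕ) {β : ℝ} (hβ : n < β) :
    IsProbabilityMeasure (expSumMeasure n β) ∧ MemLp id 2 (expSumMeasure n β) ∧
      Var[id; expSumMeasure n β] = ∑ i ∈ Finset.range (n + 1), ((β - (i : ℝ))⁻¹) ^ 2 := by
  induction n generalizing β with
  | zero =>
    have h : 0 < β := by simpa using hβ
    exact ⟨isProbabilityMeasure_expMeasure h, memLp_id_expMeasure h,
      by simp [expSumMeasure, variance_id_expMeasure h]⟩
  | succ n ih =>
    push_cast at hβ
    have h : 0 < β := by linarith [n.cast_nonneg (α := ℝ)]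
    obtain ⟨h1, h2, h3⟩ := ih (β := β - 1) (by linarith)
    have := isProbabilityMeasure_expMeasure h
    refine ⟨?_, ?_, ?_⟩
    · rw [expSumMeasure]
      infer_instance
    · rwa [expSumMeasure, memLp_id_conv_expMeasure_iff h]
    · rw [expSumMeasure, variance_id_conv_expMeasure h h2, h3, Finset.sum_range_succ' _ (n + 1)]
      simp [sub_sub, add_comm]

/-- The density of `expSumMeasure n β`, up to the normalizing constant `c`. -/
noncomputable def expSumDensity (n : ℕ) (β c t : ℝ) : ℝ :=
  if 0 ≤ t then c * exp (-(β * t)) * (exp t - 1) ^ n else 0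

lemma expSumDensity_nonneg (n : ℕ) (β : ℝ) {c : ℝ} (hc : 0 ≤ c) (t : ℝ) :
    0 ≤ expSumDensity n β c t := by
  unfold expSumDensity
  split_ifs with ht
  · have : 0 ≤ exp t - 1 := by simpa using ht
    positivity
  · rfl

@[fun_prop]
lemma measurable_expSumDensity (n : ℕ) (β c : ℝ) : Measurable (expSumDensity n β c) :=
  Measurable.ite measurableSet_Ici (by fun_prop) measurable_const

lemma setLIntegral_Iic_expSumDensity (n : ℕ) {c : ℝ} (hc : 0 < c) (w : ℝ) :
    ∫⁻ t in Set.Iic w, ENNReal.ofReal (expSumDensity n (-1) c t) =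
      ENNReal.ofReal (if 0 ≤ w then c / (n + 1) * (exp w - 1) ^ (n + 1) else 0) := by
  split_ifs with hw
  · have hint : ∫ t in (0 : ℝ)..w, c * exp t * (exp t - 1) ^ n =
        c / (n + 1) * (exp w - 1) ^ (n + 1) := by
      rw [intervalIntegral.integral_eq_sub_of_hasDerivAt
        (f := fun t => c / (n + 1) * (exp t - 1) ^ (n + 1))]
      · simp
      · intro t _
        have h := (((hasDerivAt_exp t).sub_const 1).pow (n + 1)).const_mul (c / (n + 1))
        refine h.congr_deriv ?_
        simp only [Nat.cast_add, Nat.cast_one, Nat.add_sub_cancel]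
        field_simp
      · exact Continuous.intervalIntegrable (by fun_prop) _ _
    rw [← hint, intervalIntegral.integral_of_le hw, ← integral_Icc_eq_integral_Ioc,
      ofReal_integral_eq_lintegral_ofReal]
    · rw [← lintegral_indicator measurableSet_Iic, ← lintegral_indicator measurableSet_Icc]
      refine lintegral_congr fun t => ?_
      by_cases h0 : 0 ≤ t <;> by_cases h1 : t ≤ w <;> simp [expSumDensity, h0, h1]
    · exact (Continuous.integrableOn_Icc (by fun_prop))
    · refine (ae_restrict_iff' measurableSet_Icc).2 (Filter.Eventually.of_forall fun t ht => ?_)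
      have : 0 ≤ exp t - 1 := by simpa using ht.1
      simp only [Pi.zero_apply]
      positivity
  · rw [setLIntegral_congr_fun (g := fun _ => 0) measurableSet_Iic]
    · simp
    · intro t ht
      have : ¬ 0 ≤ t := fun h => hw (h.trans ht)
      simp [expSumDensity, this]

lemma expSumMeasure_eq_withDensity (n : ℕ) {β : ℝ} (hβ : n < β) :
    ∃ c : ℝ, 0 < c ∧
      expSumMeasure n β = volume.withDensity fun t => ENNReal.ofReal (expSumDensity n β c t) := by
  induction n generalizing β with
  | zero =>
    have h : 0 < β := by simpa using hβ
    refine ⟨β, h, ?_⟩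
    rw [expSumMeasure, expMeasure_eq_withDensity]
    congr 1
    ext t
    simp [exponentialPDFReal, gammaPDFReal, expSumDensity]
  | succ n ih =>
    push_cast at hβ
    have h : 0 < β := by linarith [n.cast_nonneg (α := ℝ)]
    obtain ⟨c, hc, hd⟩ := ih (β := β - 1) (by linarith)
    refine ⟨β * (c / (n + 1)), by positivity, ?_⟩
    have hρ : volume.withDensity (fun t => ENNReal.ofReal (expSumDensity n (β - 1) c t)) =
        (volume.withDensity fun t => ENNReal.ofReal (expSumDensity n (-1) c t)).withDensity
          fun u => ENNReal.ofReal (exp (-(β * u))) := by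
      rw [← withDensity_mul _ (by fun_prop) (by fun_prop)]
      congr 1
      ext t
      rw [Pi.mul_apply, ← ENNReal.ofReal_mul (expSumDensity_nonneg _ _ hc.le _)]
      congr 1
      unfold expSumDensity
      split_ifs with ht
      · rw [show -((β - 1) * t) = -(-1 * t) + -(β * t) by ring, exp_add]
        ring
      · simp
    rw [expSumMeasure, hd, hρ, withDensity_exp_conv_expMeasure _ h]
    congr 1
    ext w
    rw [withDensity_apply _ measurableSet_Iic, setLIntegral_Iic_expSumDensity n hc,
      ← ENNReal.ofReal_mul (by positivity)]
    congr 1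
    unfold expSumDensity
    split_ifs with hw
    · ring
    · simp

lemma ae_eq_zero_of_integral_affine_mul_eq_zero {D : ℝ → ℝ} (h0 : Integrable D)
    (h1 : Integrable fun u => u * D u) (e0 : ∫ u, D u = 0) (e1 : ∫ u, u * D u = 0) {α γ : ℝ}
    (hαγ : α ≠ 0 ∨ γ ≠ 0) (hD : ∀ u, 0 ≤ (α * u + γ) * D u) : D =ᵐ[volume] 0 := by
  have hint : Integrable fun u => (α * u + γ) * D u :=
    ((h1.const_mul α).add (h0.const_mul γ)).congr (.of_forall fun u => by simp; ring)
  have hz : ∫ u, (α * u + γ) * D u = 0 := by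
    have : ∀ u, (α * u + γ) * D u = α * (u * D u) + γ * D u := fun u => by ring
    simp_rw [this]
    rw [integral_add (h1.const_mul α) (h0.const_mul γ), integral_const_mul, integral_const_mul,
      e0, e1]
    simp
  rw [integral_eq_zero_iff_of_nonneg hD hint] at hz
  have hne : ∀ᵐ u : ℝ, α * u + γ ≠ 0 := by
    rcases eq_or_ne α 0 with rfl | hα
    · simpa using hαγ
    · have : ∀ᵐ u : ℝ, u ≠ -γ / α := by simp [ae_iff]
      filter_upwards [this] with u hu h
      apply hu
      field_simp
      linarith
  filter_upwards [hz, hne] with u hu hu'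
  simpa [hu'] using hu

/-- If `D` changes sign at most twice, from negative to positive to negative, and has vanishing
zeroth and first moments, then its second moment is nonpositive. -/
lemma integral_sq_mul_nonpos_of_ordConnected {D : ℝ → ℝ} (h0 : Integrable D)
    (h1 : Integrable fun u => u * D u) (h2 : Integrable fun u => u ^ 2 * D u)
    (e0 : ∫ u, D u = 0) (e1 : ∫ u, u * D u = 0) (hS : {u | 0 < D u}.OrdConnected) :
    ∫ u, u ^ 2 * D u ≤ 0 := by
  set S := {u | 0 < D u} with hSdef
  have hzero : ∀ {α γ : ℝ}, (α ≠ 0 ∨ γ ≠ 0) → (∀ u, 0 ≤ (α * u + γ) * D u) →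
      ∫ u, u ^ 2 * D u ≤ 0 := by
    intro α γ hαγ hD
    have h := ae_eq_zero_of_integral_affine_mul_eq_zero h0 h1 e0 e1 hαγ hD
    refine le_of_eq (integral_eq_zero_of_ae ?_)
    filter_upwards [h] with u hu
    simp [hu]
  have hpos : ∀ {u v w}, u ∈ S → w ∈ S → u ≤ v → v ≤ w → 0 < D v := fun hu hw huv hvw =>
    hS.out hu hw ⟨huv, hvw⟩
  have hneg : ∀ {u}, u ∉ S → D u ≤ 0 := fun hu => not_lt.1 hu
  rcases S.eq_empty_or_nonempty with hE | ⟨s, hs⟩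
  · refine hzero (α := 0) (γ := -1) (by simp) fun u => ?_
    have : D u ≤ 0 := hneg (by simp [hE])
    linarith
  by_cases hb : BddBelow S
  · have hlow : ∀ {u}, u < sInf S → D u ≤ 0 := fun hu =>
      hneg fun hmem => absurd (csInf_le hb hmem) (not_le.2 hu)
    by_cases ha : BddAbove S
    · have hhigh : ∀ {u}, sSup S < u → D u ≤ 0 := fun hu =>
        hneg fun hmem => absurd (le_csSup ha hmem) (not_le.2 hu)
      have key : ∀ u, (u - sInf S) * (u - sSup S) * D u ≤ 0 := by
        intro u
        have hle : sInf S ≤ sSup S := (csInf_le hb hs).trans (le_csSup ha hs)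
        rcases lt_or_ge u (sInf S) with h | h
        · exact mul_nonpos_of_nonneg_of_nonpos
            (mul_nonneg_of_nonpos_of_nonpos (by linarith) (by linarith)) (hlow h)
        rcases lt_or_ge (sSup S) u with h' | h'
        · exact mul_nonpos_of_nonneg_of_nonpos (mul_nonneg (by linarith) (by linarith)) (hhigh h')
        rcases h.eq_or_lt with rfl | h
        · simp
        rcases h'.eq_or_lt with rfl | h'
        · simp
        obtain ⟨s₁, hs₁, hu₁⟩ := exists_lt_of_csInf_lt ⟨s, hs⟩ h
        obtain ⟨s₂, hs₂, hu₂⟩ := exists_lt_of_lt_csSup ⟨s, hs⟩ h'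
        exact mul_nonpos_of_nonpos_of_nonneg
          (mul_nonpos_of_nonneg_of_nonpos (by linarith) (by linarith))
          (hpos hs₁ hs₂ hu₁.le hu₂.le).le
      have hexp : ∫ u, (u - sInf S) * (u - sSup S) * D u = ∫ u, u ^ 2 * D u := by
        have : ∀ u, (u - sInf S) * (u - sSup S) * D u =
            u ^ 2 * D u - (sInf S + sSup S) * (u * D u) + sInf S * sSup S * D u := fun u => by ring
        have hi : Integrable fun u => u ^ 2 * D u - (sInf S + sSup S) * (u * D u) :=
          h2.sub (h1.const_mul _)
        simp_rw [this]
        rw [integral_add hi (h0.const_mul _),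
          integral_sub h2 (h1.const_mul _), integral_const_mul, integral_const_mul, e0, e1]
        simp
      exact hexp ▸ integral_nonpos key
    · refine hzero (α := 1) (γ := -sInf S) (by simp) fun u => ?_
      rcases lt_trichotomy u (sInf S) with h | h | h
      · exact mul_nonneg_of_nonpos_of_nonpos (by linarith) (hlow h)
      · simp [h]
      · obtain ⟨s₁, hs₁, hu₁⟩ := exists_lt_of_csInf_lt ⟨s, hs⟩ h
        obtain ⟨s₂, hs₂, hu₂⟩ := not_bddAbove_iff.1 ha u
        exact mul_nonneg (by linarith) (hpos hs₁ hs₂ hu₁.le hu₂.le).le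
  · by_cases ha : BddAbove S
    · refine hzero (α := -1) (γ := sSup S) (by simp) fun u => ?_
      rcases lt_trichotomy u (sSup S) with h | h | h
      · obtain ⟨s₁, hs₁, hu₁⟩ := not_bddBelow_iff.1 hb u
        obtain ⟨s₂, hs₂, hu₂⟩ := exists_lt_of_lt_csSup ⟨s, hs⟩ h
        exact mul_nonneg (by linarith) (hpos hs₁ hs₂ hu₁.le hu₂.le).le
      · simp [h]
      · exact mul_nonneg_of_nonpos_of_nonpos (by linarith)
          (hneg fun hmem => absurd (le_csSup ha hmem) (not_le.2 h))
    · refine hzero (α := 0) (γ := 1) (by simp) fun u => ?_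
      obtain ⟨s₁, hs₁, hu₁⟩ := not_bddBelow_iff.1 hb u
      obtain ⟨s₂, hs₂, hu₂⟩ := not_bddAbove_iff.1 ha u
      have := hpos hs₁ hs₂ hu₁.le hu₂.le
      linarith

lemma variance_id_le_of_ordConnected {w p : ℝ → ℝ} (hw : Measurable w) (hp : Measurable p)
    (hw0 : ∀ u, 0 ≤ w u) (hp0 : ∀ u, 0 ≤ p u) {μ ν : Measure ℝ} [IsProbabilityMeasure μ]
    [IsProbabilityMeasure ν] (hμ : μ = volume.withDensity fun u => ENNReal.ofReal (w u))
    (hν : ν = volume.withDensity fun u => ENNReal.ofReal (p u)) (hμ2 : MemLp id 2 μ)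
    (hν2 : MemLp id 2 ν) (hmean : ∫ u, u ∂μ = ∫ u, u ∂ν) (hS : {u | p u < w u}.OrdConnected) :
    Var[id; μ] ≤ Var[id; ν] := by
  have hsq := hμ2.integrable_sq
  have hsq' := hν2.integrable_sq
  have hid : Integrable (fun u => u) μ := hμ2.integrable one_le_two
  have hid' : Integrable (fun u => u) ν := hν2.integrable one_le_two
  have hone : Integrable (fun _ => (1 : ℝ)) μ := integrable_const 1
  have hone' : Integrable (fun _ => (1 : ℝ)) ν := integrable_const 1
  have tot : ∫ _, (1 : ℝ) ∂μ = ∫ _, (1 : ℝ) ∂ν := by simp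
  rw [variance_eq_sub hμ2, variance_eq_sub hν2]
  simp only [Pi.pow_apply, id] at hsq hsq' ⊢
  rw [hmean]
  refine sub_le_sub_right ?_ _
  rw [hμ, integrable_withDensity_ofReal_iff hw hw0] at hsq hid hone
  rw [hν, integrable_withDensity_ofReal_iff hp hp0] at hsq' hid' hone'
  rw [hμ, hν, integral_withDensity_ofReal hw hw0, integral_withDensity_ofReal hp hp0] at hmean tot ⊢
  have h := integral_sq_mul_nonpos_of_ordConnected (D := fun u => w u - p u)
    ((hone.sub hone').congr (.of_forall fun u => by simp))
    ((hid.sub hid').congr (.of_forall fun u => by simp; ring))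
    ((hsq.sub hsq').congr (.of_forall fun u => by simp; ring))
    (by
      rw [← sub_eq_zero, ← integral_sub hone hone'] at tot
      simpa using tot)
    (by
      rw [← sub_eq_zero, ← integral_sub hid hid'] at hmean
      rw [← hmean]
      congr 1
      ext u
      ring)
    (by simpa using hS)
  rw [← sub_nonpos, ← integral_sub hsq hsq']
  refine le_of_eq_of_le ?_ h
  congr 1
  ext u
  ring

lemma sum_range_succ_inv_sub_sq (n : ℕ) (β : ℝ) :
    ∑ i ∈ Finset.range (n + 1), ((β - (i : ℝ))⁻¹) ^ 2 =
      ∑ i ∈ Finset.Icc 1 n, ((β - (i : ℝ))⁻¹) ^ 2 + β⁻¹ ^ 2 := by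
  rw [Finset.sum_range_succ', ← Finset.Ico_add_one_right_eq_Icc, Finset.sum_Ico_eq_sum_range]
  simp [add_comm]

lemma map_add_const_withDensity {g : ℝ → ℝ≥0∞} (hg : Measurable g) (b : ℝ) :
    (volume.withDensity g).map (fun u => u + b) = volume.withDensity fun u => g (u - b) := by
  refine Measure.ext_of_lintegral _ fun k hk => ?_
  rw [lintegral_map hk (by fun_prop), lintegral_withDensity_eq_lintegral_mul _ hg (by fun_prop),
    lintegral_withDensity_eq_lintegral_mul _ (by fun_prop) hk,
    ← lintegral_add_right_eq_self ((fun u => g (u - b)) * k) b]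
  simp

/-- The law of `-β⁻¹ log f` under the measure with density `f`, convolved with the exponential
distribution of rate `β`, has a density given by the volumes of the superlevel sets of `f`. -/
lemma map_neg_log_conv_expMeasure {n : ℕ} {β : ℝ} (hβ : 0 < β) {f : (Fin n → ℝ) → ℝ}
    (hf : Measurable f) (hf0 : ∀ x, 0 ≤ f x) :
    ((volume.withDensity fun x => ENNReal.ofReal (f x)).map fun x => -log (f x) / β) ∗
        expMeasure β =
      volume.withDensity fun w =>
        ENNReal.ofReal (β * exp (-(β * w))) * volume {x | exp (-(β * w)) ≤ f x} := by
  have hpos : MeasurableSet {x | 0 < f x} := measurableSet_lt measurable_const hf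
  set ρ : Measure ℝ := (volume.restrict {x | 0 < f x}).map fun x => -log (f x) / β with hρ
  have hexp : ∀ x, 0 < f x → exp (-(β * (-log (f x) / β))) = f x := by
    intro x hx
    rw [mul_div_cancel₀ _ hβ.ne', neg_neg, exp_log hx]
  have hP : ((volume.withDensity fun x => ENNReal.ofReal (f x)).map fun x => -log (f x) / β) =
      ρ.withDensity fun u => ENNReal.ofReal (exp (-(β * u))) := by
    refine Measure.ext_of_lintegral _ fun k hk => ?_
    rw [lintegral_map hk (by fun_prop), lintegral_withDensity_eq_lintegral_mul _ (by fun_prop)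
      (by fun_prop), lintegral_withDensity_eq_lintegral_mul _ (by fun_prop) hk,
      lintegral_map (by fun_prop) (by fun_prop), ← lintegral_indicator hpos]
    refine lintegral_congr fun x => ?_
    by_cases hx : 0 < f x
    · simp [hx, hexp x hx]
    · simp [le_antisymm (not_lt.1 hx) (hf0 x)]
  rw [hP, withDensity_exp_conv_expMeasure ρ hβ]
  congr 1
  ext w
  rw [hρ, Measure.map_apply (by fun_prop) measurableSet_Iic,
    Measure.restrict_apply (measurableSet_Iic.preimage (by fun_prop))]
  congr 2
  ext x
  simp only [Set.mem_inter_iff, Set.mem_preimage, Set.mem_Iic, Set.mem_ofPred_eq]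
  constructor
  · rintro ⟨h, hx⟩
    rw [div_le_iff₀ hβ] at h
    rw [← exp_log hx]
    exact exp_le_exp.2 (by linarith)
  · intro h
    have hx := (exp_pos _).trans_le h
    refine ⟨?_, hx⟩
    rw [div_le_iff₀ hβ]
    have := (le_log_iff_exp_le hx).2 h
    linarith

lemma volume_superlevel_lt_top {n : ℕ} {f : (Fin n → ℝ) → ℝ}
    (hf : Measurable f) [IsFiniteMeasure (volume.withDensity fun x => ENNReal.ofReal (f x))]
    {s : ℝ} (hs : 0 < s) : volume {x | s ≤ f x} < ∞ := by
  have h := meas_ge_le_lintegral_div (μ := (volume : Measure (Fin n → ℝ)))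
    (f := fun x => ENNReal.ofReal (f x)) (by fun_prop) (ε := ENNReal.ofReal s) (by simpa using hs)
    ENNReal.ofReal_ne_top
  refine lt_of_le_of_lt (le_trans (measure_mono fun x hx => ENNReal.ofReal_le_ofReal hx) h)
    (ENNReal.div_lt_top ?_ (by simpa using hs))
  have := measure_ne_top (volume.withDensity fun x => ENNReal.ofReal (f x)) Set.univ
  rwa [withDensity_apply _ MeasurableSet.univ, setLIntegral_univ] at this

/-- The superlevel sets of a `(-1/β)`-concave function satisfy a Brunn–Minkowski inequality. -/
lemma ofReal_pow_le_volume_superlevel {n : ℕ} {β : ℝ} (hβ : 0 < β) {f : (Fin n → ℝ) → ℝ}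
    (hf : Measurable f) (hconv : ConvexOn ℝ {x | 0 < f x} fun x => f x ^ (-1 / β))
    {u v w a b r s : ℝ} (ha : 0 < a) (hb : 0 < b) (hab : a + b = 1)
    (huvw : a * exp u + b * exp v = exp w) (hr : 0 < r) (hs : 0 < s)
    (hu : volume {x | exp (-(β * u)) ≤ f x} = ENNReal.ofReal (r ^ n))
    (hv : volume {x | exp (-(β * v)) ≤ f x} = ENNReal.ofReal (s ^ n)) :
    ENNReal.ofReal ((a * r + b * s) ^ n) ≤ volume {x | exp (-(β * w)) ≤ f x} := by
  have hm : ∀ q, MeasurableSet {x | q ≤ f x} := fun q => measurableSet_le measurable_const hf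
  refine ofReal_pow_le_volume (hm _) (hm _) (hm _) ha hb hr hs hu hv fun x hx y hy => ?_
  have hpow : ∀ t : ℝ, exp (-(β * t)) ^ (-1 / β) = exp t := by
    intro t
    rw [← exp_mul]
    congr 1
    field_simp
  have hlevel : ∀ z t, exp (-(β * t)) ≤ f z → f z ^ (-1 / β) ≤ exp t := fun z t hz =>
    hpow t ▸ rpow_le_rpow_of_nonpos (exp_pos _) hz (div_nonpos_of_nonpos_of_nonneg (by simp) hβ.le)
  have hx0 : 0 < f x := (exp_pos _).trans_le hx
  have hy0 : 0 < f y := (exp_pos _).trans_le hy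
  have hz0 : 0 < f (a • x + b • y) := hconv.1 hx0 hy0 ha.le hb.le hab
  have key : f (a • x + b • y) ^ (-1 / β) ≤ exp w := by
    refine (hconv.2 hx0 hy0 ha.le hb.le hab).trans ?_
    rw [← huvw, smul_eq_mul, smul_eq_mul]
    gcongr
    · exact hlevel x u hx
    · exact hlevel y v hy
  rw [← hpow w] at key
  exact (rpow_le_rpow_iff_of_neg hz0 (exp_pos _) (div_neg_of_neg_of_pos (by simp) hβ)).1 key

/-- Upper bound for the variance of `-β⁻¹ log f` under a `(-1/β)`-concave density `f`. -/
lemma variance_neg_log_div_le {n : ℕ} (hn : n ≠ 0) {β : ℝ} (hβ : n < β) {f : (Fin n → ℝ) → ℝ}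
    (hf : Measurable f) (hf0 : ∀ x, 0 ≤ f x)
    [hprob : IsProbabilityMeasure (volume.withDensity fun x => ENNReal.ofReal (f x))]
    (hconv : ConvexOn ℝ {x | 0 < f x} fun x => f x ^ (-1 / β)) :
    Var[fun x => -log (f x) / β; volume.withDensity fun x => ENNReal.ofReal (f x)] ≤
      ∑ i ∈ Finset.Icc 1 n, ((β - (i : ℝ))⁻¹) ^ 2 := by
  have hβ0 : 0 < β := n.cast_nonneg.trans_lt hβ
  set P := (volume.withDensity fun x => ENNReal.ofReal (f x)).map fun x => -log (f x) / β with hP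
  have hPprob : IsProbabilityMeasure P := Measure.isProbabilityMeasure_map (by fun_prop)
  have hExp := isProbabilityMeasure_expMeasure hβ0
  rw [← variance_id_map (by fun_prop), ← hP]
  by_cases hP2 : MemLp id 2 P
  swap
  · rw [variance_of_not_memLp aestronglyMeasurable_id hP2]
    positivity
  set V : ℝ → ℝ := fun w => (volume {x | exp (-(β * w)) ≤ f x}).toReal with hV
  have hVfin : ∀ w, volume {x | exp (-(β * w)) ≤ f x} = ENNReal.ofReal (V w) := fun w =>
    (ENNReal.ofReal_toReal (volume_superlevel_lt_top hf (exp_pos _)).ne).symm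
  have hV0 : ∀ w, 0 ≤ V w := fun w => ENNReal.toReal_nonneg
  have hVmono : Monotone V := by
    intro s t hst
    refine ENNReal.toReal_mono (volume_superlevel_lt_top hf (exp_pos _)).ne
      (measure_mono fun x hx => ?_)
    rw [Set.mem_ofPred_eq] at hx ⊢
    exact le_trans (by gcongr) hx
  have hVm : Measurable V := hVmono.measurable
  have hW : P ∗ expMeasure β =
      volume.withDensity fun w => ENNReal.ofReal (β * exp (-(β * w)) * V w) := by
    rw [hP, map_neg_log_conv_expMeasure hβ0 hf hf0]
    congr 1
    ext w
    rw [hVfin, ← ENNReal.ofReal_mul (by positivity)]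
  obtain ⟨hTprob, hT2, hTvar⟩ := expSumMeasure_spec n hβ
  obtain ⟨c, hc, hT⟩ := expSumMeasure_eq_withDensity n hβ
  set b := ∫ u, u ∂(P ∗ expMeasure β) - ∫ u, u ∂(expSumMeasure n β) with hb
  set T' := (expSumMeasure n β).map (fun u => u + b) with hT'
  have hT'prob : IsProbabilityMeasure T' := Measure.isProbabilityMeasure_map (by fun_prop)
  have hT'2 : MemLp id 2 T' := by
    rw [hT', memLp_map_measure_iff aestronglyMeasurable_id (by fun_prop)]
    exact hT2.add (memLp_const b)
  have hT'var : Var[id; T'] = Var[id; expSumMeasure n β] := by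
    rw [hT', variance_id_map (by fun_prop)]
    exact variance_add_const aestronglyMeasurable_id b
  have hT'mean : ∫ u, u ∂(P ∗ expMeasure β) = ∫ u, u ∂T' := by
    have hi : Integrable (fun u => u) (expSumMeasure n β) := hT2.integrable one_le_two
    rw [hT', integral_map (by fun_prop) (by fun_prop), integral_add hi (integrable_const _)]
    simp [hb]
  have hT'd : T' = volume.withDensity fun u => ENNReal.ofReal (expSumDensity n β c (u - b)) := by
    rw [hT', hT, map_add_const_withDensity (by fun_prop)]
  have hκ : ∃ κ : ℝ, 0 ≤ κ ∧ κ ^ n = c * exp (β * b) / β :=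
    ⟨(c * exp (β * b) / β) ^ (n⁻¹ : ℝ), by positivity,
      Real.rpow_inv_natCast_pow (by positivity) hn⟩
  obtain ⟨κ, hκ0, hκ⟩ := hκ
  set q : ℝ → ℝ := fun s => κ * max (exp (-b) * s - 1) 0 with hq
  have hq0 : ∀ s, 0 ≤ q s := fun s => by positivity
  have hdens : ∀ u, expSumDensity n β c (u - b) = β * exp (-(β * u)) * q (exp u) ^ n := by
    intro u
    have he : exp (u - b) = exp (-b) * exp u := by rw [← exp_add]; ring_nf
    unfold expSumDensity
    split_ifs with h
    · have h1 : 0 ≤ exp (-b) * exp u - 1 := by rw [← he]; simpa using h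
      rw [hq]
      simp only [max_eq_left h1, mul_pow, hκ, he]
      rw [show -(β * (u - b)) = -(β * u) + β * b by ring, exp_add]
      field_simp
    · have h1 : exp (-b) * exp u - 1 ≤ 0 := by
        rw [← he]
        simpa using (not_le.1 h).le
      simp [hq, max_eq_right h1, hn]
  have hmem : ∀ u, expSumDensity n β c (u - b) < β * exp (-(β * u)) * V u ↔
      q (exp u) ^ n < V u := fun u => by
    rw [hdens, mul_lt_mul_iff_right₀ (by positivity)]
  have hS : {u | expSumDensity n β c (u - b) < β * exp (-(β * u)) * V u}.OrdConnected := by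
    refine Set.ordConnected_of_Ioo fun u hu v hv huv w hw => ?_
    simp only [Set.mem_ofPred_eq, hmem] at hu hv ⊢
    have hroot : ∀ t, q (exp t) ^ n < V t → ∃ r, q (exp t) < r ∧ r ^ n = V t := by
      intro t ht
      have hr : (V t ^ (n⁻¹ : ℝ)) ^ n = V t := Real.rpow_inv_natCast_pow (hV0 t) hn
      exact ⟨_, lt_of_pow_lt_pow_left₀ n (by have := hV0 t; positivity) (ht.trans_eq hr.symm), hr⟩
    obtain ⟨r, hqr, hr⟩ := hroot u hu
    obtain ⟨s, hqs, hs⟩ := hroot v hv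
    have hcomb : exp w ∈ openSegment ℝ (exp u) (exp v) := by
      rw [openSegment_eq_Ioo (exp_lt_exp.2 huv)]
      exact ⟨exp_lt_exp.2 hw.1, exp_lt_exp.2 hw.2⟩
    obtain ⟨α, γ, hα, hγ, hαγ, hcomb⟩ := hcomb
    simp only [smul_eq_mul] at hcomb
    have hbm := ofReal_pow_le_volume_superlevel hβ0 hf hconv hα hγ hαγ hcomb
      ((hq0 _).trans_lt hqr) ((hq0 _).trans_lt hqs) (by rw [hVfin, hr]) (by rw [hVfin, hs])
    rw [hVfin, ENNReal.ofReal_le_ofReal_iff (hV0 w)] at hbm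
    refine lt_of_lt_of_le (pow_lt_pow_left₀ ?_ (hq0 _) hn) hbm
    have hqconv : q (exp w) ≤ α * q (exp u) + γ * q (exp v) := by
      rw [← hcomb]
      have hmax : max (exp (-b) * (α * exp u + γ * exp v) - 1) 0 ≤
          α * max (exp (-b) * exp u - 1) 0 + γ * max (exp (-b) * exp v - 1) 0 := by
        refine max_le ?_ (by positivity)
        calc exp (-b) * (α * exp u + γ * exp v) - 1
            = α * (exp (-b) * exp u - 1) + γ * (exp (-b) * exp v - 1) := by
              linear_combination hαγ
          _ ≤ _ := by gcongr <;> exact le_max_left _ _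
      calc q (α * exp u + γ * exp v)
          ≤ κ * (α * max (exp (-b) * exp u - 1) 0 + γ * max (exp (-b) * exp v - 1) 0) :=
            mul_le_mul_of_nonneg_left hmax hκ0
        _ = _ := by simp only [hq]; ring
    refine hqconv.trans_lt ?_
    gcongr
  have hle := variance_id_le_of_ordConnected (by fun_prop) (by fun_prop)
    (fun u => by have := hV0 u; positivity) (fun u => expSumDensity_nonneg n β hc.le _) hW hT'd
    ((memLp_id_conv_expMeasure_iff hβ0).2 hP2) hT'2 hT'mean hS
  rw [hT'var, hTvar, variance_id_conv_expMeasure hβ0 hP2, sum_range_succ_inv_sub_sq] at hle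
  linarith

/-- A `(-1/β)`-concave function agrees almost everywhere with a measurable one. -/
lemma exists_measurable_ae_eq_of_convexOn {n : ℕ} {β : ℝ} {f : (Fin n → ℝ) → ℝ} (hβ : 0 < β)
    (hf0 : ∀ x, 0 ≤ f x) (hconv : ConvexOn ℝ {x | 0 < f x} fun x => f x ^ (-1 / β)) :
    ∃ f' : (Fin n → ℝ) → ℝ, Measurable f' ∧ (∀ x, 0 ≤ f' x) ∧ f =ᵐ[volume] f' ∧
      ConvexOn ℝ {x | 0 < f' x} fun x => f' x ^ (-1 / β) := by
  classical
  set K := {x | 0 < f x} with hK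
  have hcont : ContinuousOn f (interior K) := by
    have h : ContinuousOn (fun x => (f x ^ (-1 / β)) ^ (-β)) (interior K) := by
      refine hconv.continuousOn_interior.rpow_const fun x hx => Or.inl ?_
      exact (rpow_pos_of_pos (interior_subset (s := K) hx) _).ne'
    refine h.congr fun x hx => ?_
    beta_reduce
    rw [← rpow_mul (hf0 x)]
    have : -1 / β * -β = 1 := by field_simp
    rw [this, rpow_one]
  have hpos : {x | 0 < (interior K).indicator f x} = interior K := by
    ext x
    by_cases hx : x ∈ interior K
    · have hxK : 0 < f x := interior_subset (s := K) hx
      simp [hx, hxK]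
    · simp [hx]
  refine ⟨(interior K).indicator f, ?_, ?_, ?_, ?_⟩
  · rw [← Set.piecewise_eq_indicator]
    exact hcont.measurable_piecewise continuousOn_const isOpen_interior.measurableSet
  · exact fun x => Set.indicator_nonneg (fun x _ => hf0 x) x
  · have hfr : ∀ᵐ x, x ∉ frontier K := by
      rw [ae_iff]
      simpa using hconv.1.addHaar_frontier volume
    filter_upwards [hfr] with x hx
    by_cases hxi : x ∈ interior K
    · simp [hxi]
    · have hxK : x ∉ K := fun h => hx ⟨subset_closure h, hxi⟩
      simp only [hxi, not_false_eq_true, Set.indicator_of_notMem]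
      exact le_antisymm (not_lt.1 hxK) (hf0 x)
  · rw [hpos]
    refine (hconv.subset interior_subset hconv.1.interior).congr fun x hx => ?_
    simp [hx]

lemma variance_neg_log_comp_le {Ω : Type*} [MeasureSpace Ω] [IsProbabilityMeasure (ℙ : Measure Ω)]
    {n : ℕ} {β : ℝ} (hβ : (n : ℝ) < β) {X : Ω → (Fin n → ℝ)} (hX : Measurable X)
    {f : (Fin n → ℝ) → ℝ} (hf_nonneg : ∀ x, 0 ≤ f x)
    (hf_density : Measure.map X ℙ = volume.withDensity (fun x => ENNReal.ofReal (f x)))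
    (hf_conv : ConvexOn ℝ {x | 0 < f x} (fun x => f x ^ (-1 / β))) :
    Var[fun ω => -log (f (X ω)); ℙ] ≤ β ^ 2 * ∑ i ∈ Finset.Icc 1 n, ((β - (i : ℝ))⁻¹) ^ 2 := by
  have hβ0 : 0 < β := n.cast_nonneg.trans_lt hβ
  rcases eq_or_ne n 0 with rfl | hn
  · have : (fun ω => -log (f (X ω))) = fun _ => -log (f default) := by
      ext ω
      rw [Subsingleton.elim (X ω) default]
    rw [this]
    generalize -log (f default) = c
    rw [variance_eq_integral aemeasurable_const]
    simp
  obtain ⟨g, hg, hg0, hfg, hgconv⟩ := exists_measurable_ae_eq_of_convexOn hβ0 hf_nonneg hf_conv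
  have hdens : Measure.map X ℙ = volume.withDensity fun x => ENNReal.ofReal (g x) := by
    rw [hf_density]
    refine withDensity_congr_ae ?_
    filter_upwards [hfg] with x hx
    rw [hx]
  have hprob : IsProbabilityMeasure (volume.withDensity fun x => ENNReal.ofReal (g x)) :=
    hdens ▸ Measure.isProbabilityMeasure_map hX.aemeasurable
  have hae : (fun ω => -log (f (X ω))) =ᵐ[ℙ] fun ω => β * (-log (g (X ω)) / β) := by
    have h : ∀ᵐ x ∂(Measure.map X ℙ), f x = g x :=
      hf_density ▸ (withDensity_absolutelyContinuous _ _).ae_le hfg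
    filter_upwards [ae_of_ae_map hX.aemeasurable h] with ω hω
    rw [hω]
    field_simp
  rw [variance_congr hae, variance_const_mul]
  refine mul_le_mul_of_nonneg_left ?_ (sq_nonneg β)
  have h := variance_neg_log_div_le hn hβ hg hg0 hgconv
  rwa [← hdens, variance_map (by fun_prop) hX.aemeasurable] at h

lemma volume_simplex_eq {n : ℕ} {s : ℝ} (hs : 0 < s) :
    volume {x : Fin n → ℝ | (∀ i, 0 < x i) ∧ ∑ i, x i ≤ s} =
      ENNReal.ofReal (s ^ n) * volume {x : Fin n → ℝ | (∀ i, 0 < x i) ∧ ∑ i, x i ≤ 1} := by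
  have h := Measure.addHaar_smul_of_nonneg (volume : Measure (Fin n → ℝ)) hs.le
    {x : Fin n → ℝ | (∀ i, 0 < x i) ∧ ∑ i, x i ≤ 1}
  simp only [Module.finrank_fin_fun] at h
  rw [← h]
  congr 1
  ext x
  rw [Set.mem_smul_set_iff_inv_smul_mem₀ hs.ne']
  simp [← Finset.mul_sum, hs, inv_mul_le_iff₀ hs]

lemma volume_unit_simplex_ne_zero (n : ℕ) :
    volume {x : Fin n → ℝ | (∀ i, 0 < x i) ∧ ∑ i, x i ≤ 1} ≠ 0 := by
  have hopen : IsOpen {x : Fin n → ℝ | (∀ i, 0 < x i) ∧ ∑ i, x i < 1} := by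
    refine IsOpen.and ?_ (isOpen_lt (by fun_prop) continuous_const)
    simp only [Set.ofPred_forall]
    exact isOpen_iInter_of_finite fun i => isOpen_lt continuous_const (by fun_prop)
  have hne : {x : Fin n → ℝ | (∀ i, 0 < x i) ∧ ∑ i, x i < 1}.Nonempty := by
    refine ⟨fun _ => ((n : ℝ) + 1)⁻¹, fun i => by positivity, ?_⟩
    simp only [Finset.sum_const, Finset.card_univ, Fintype.card_fin, nsmul_eq_mul]
    rw [← div_eq_mul_inv, div_lt_one (by positivity)]
    linarith
  refine ((hopen.measure_pos volume hne).trans_le (measure_mono fun x hx => ?_)).ne'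
  exact ⟨hx.1, hx.2.le⟩

lemma volume_unit_simplex_ne_top (n : ℕ) :
    volume {x : Fin n → ℝ | (∀ i, 0 < x i) ∧ ∑ i, x i ≤ 1} ≠ ∞ := by
  refine ((measure_mono fun x hx => ?_).trans_lt
    (isCompact_Icc (a := (0 : Fin n → ℝ)) (b := 1)).measure_lt_top).ne
  refine ⟨fun i => (hx.1 i).le, fun i => ?_⟩
  exact (Finset.single_le_sum (fun j _ => (hx.1 j).le) (Finset.mem_univ i)).trans hx.2

/-- The unnormalized Pareto density on the positive orthant. -/
noncomputable def paretoWeight (n : ℕ) (β a : ℝ) (x : Fin n → ℝ) : ℝ :=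
  if ∀ i, 0 < x i then (a + ∑ i, x i) ^ (-β) else 0

section Pareto

variable {n : ℕ} {β a : ℝ}

lemma measurableSet_orthant (n : ℕ) : MeasurableSet {x : Fin n → ℝ | ∀ i, 0 < x i} := by
  simp only [Set.ofPred_forall]
  exact MeasurableSet.iInter fun i => measurableSet_lt measurable_const (measurable_pi_apply i)

@[fun_prop]
lemma measurable_paretoWeight : Measurable (paretoWeight n β a) :=
  Measurable.ite (measurableSet_orthant n) (by fun_prop) measurable_const

lemma paretoWeight_nonneg (ha : 0 < a) (x : Fin n → ℝ) : 0 ≤ paretoWeight n β a x := by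
  unfold paretoWeight
  split_ifs with hx
  · have : 0 ≤ ∑ i, x i := Finset.sum_nonneg fun i _ => (hx i).le
    positivity
  · rfl

lemma paretoWeight_superlevel (hβ : 0 < β) (ha : 0 < a) (w : ℝ) :
    {x | exp (-(β * w)) ≤ paretoWeight n β a x} =
      {x | (∀ i, 0 < x i) ∧ ∑ i, x i ≤ exp w - a} := by
  ext x
  unfold paretoWeight
  simp only [Set.mem_ofPred_eq]
  split_ifs with hx
  · have : 0 ≤ ∑ i, x i := Finset.sum_nonneg fun i _ => (hx i).le
    have he : exp (-(β * w)) = exp w ^ (-β) := by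
      rw [← exp_mul]
      ring_nf
    rw [he, rpow_le_rpow_iff_of_neg (exp_pos _) (by positivity) (by linarith)]
    simp [hx, le_sub_iff_add_le']
  · simp [hx, exp_pos]

lemma exists_map_neg_log_paretoWeight_conv (hβ : n < β) (ha : 0 < a) :
    ∃ k : ℝ≥0∞, k ≠ 0 ∧ k ≠ ∞ ∧
      ((volume.withDensity fun x => ENNReal.ofReal (paretoWeight n β a x)).map
          fun x => -log (paretoWeight n β a x) / β) ∗ expMeasure β =
        k • (expSumMeasure n β).map fun u => u + log a := by
  have hβ0 : 0 < β := n.cast_nonneg.trans_lt hβ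
  obtain ⟨c, hc, hT⟩ := expSumMeasure_eq_withDensity n hβ
  set C := volume {x : Fin n → ℝ | (∀ i, 0 < x i) ∧ ∑ i, x i ≤ 1} with hC
  set d := β / (c * exp (β * log a)) * a ^ n with hd
  have hd0 : 0 < d := by positivity
  refine ⟨ENNReal.ofReal d * C, mul_ne_zero (by simpa using hd0) (volume_unit_simplex_ne_zero n),
    ENNReal.mul_ne_top ENNReal.ofReal_ne_top (volume_unit_simplex_ne_top n), ?_⟩
  rw [map_neg_log_conv_expMeasure hβ0 measurable_paretoWeight (paretoWeight_nonneg ha), hT,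
    map_add_const_withDensity (by fun_prop), ← withDensity_smul _ (by fun_prop)]
  refine withDensity_congr_ae ?_
  have hne : ∀ᵐ w : ℝ, w ≠ log a := by simp [ae_iff]
  filter_upwards [hne] with w hw
  rw [paretoWeight_superlevel hβ0 ha, Pi.smul_apply, smul_eq_mul]
  rcases lt_or_gt_of_ne hw with h | h
  · have h1 : exp w < a := (lt_log_iff_exp_lt ha).1 h
    have : {x : Fin n → ℝ | (∀ i, 0 < x i) ∧ ∑ i, x i ≤ exp w - a} = ∅ := by
      ext x
      simp only [Set.mem_ofPred_eq, Set.mem_empty_iff_false, iff_false, not_and, not_le]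
      intro hx
      have : 0 ≤ ∑ i, x i := Finset.sum_nonneg fun i _ => (hx i).le
      linarith
    simp [this, expSumDensity, h.not_ge]
  · have h1 : a < exp w := (log_lt_iff_lt_exp ha).1 h
    rw [volume_simplex_eq (sub_pos.2 h1), ← hC, ← mul_assoc, mul_right_comm (ENNReal.ofReal d),
      ← ENNReal.ofReal_mul (by positivity), ← ENNReal.ofReal_mul hd0.le]
    congr 2
    have he : exp (w - log a) - 1 = (exp w - a) / a := by
      rw [exp_sub, exp_log ha]
      field_simp
    unfold expSumDensity
    rw [if_pos (sub_nonneg.2 h.le), he, show -(β * (w - log a)) = -(β * w) + β * log a by ring,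
      exp_add, hd, div_pow]
    field_simp

/-- The varentropy of the Pareto distribution on the positive orthant. -/
lemma variance_neg_log_pareto (hβ : (n : ℝ) < β) (ha : 0 < a) :
    Var[fun x => -log (paretoWeight n β a x / ∫ y, paretoWeight n β a y);
      volume.withDensity fun x =>
        ENNReal.ofReal (paretoWeight n β a x / ∫ y, paretoWeight n β a y)] =
      β ^ 2 * ∑ i ∈ Finset.Icc 1 n, ((β - (i : ℝ))⁻¹) ^ 2 := by
  have hβ0 : 0 < β := n.cast_nonneg.trans_lt hβ
  have hExp := isProbabilityMeasure_expMeasure hβ0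
  obtain ⟨hTprob, hT2, hTvar⟩ := expSumMeasure_spec n hβ
  obtain ⟨k, hk0, hk, hconv⟩ := exists_map_neg_log_paretoWeight_conv hβ ha
  set g : (Fin n → ℝ) → ℝ := fun x => -log (paretoWeight n β a x) / β with hg
  have hgm : Measurable g := by fun_prop
  set Q₀ := volume.withDensity fun x => ENNReal.ofReal (paretoWeight n β a x) with hQ₀
  set T' := (expSumMeasure n β).map fun u => u + log a with hT'
  have hT'prob : IsProbabilityMeasure T' := Measure.isProbabilityMeasure_map (by fun_prop)
  have hT'2 : MemLp id 2 T' := by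
    rw [hT', memLp_map_measure_iff aestronglyMeasurable_id (by fun_prop)]
    exact hT2.add (memLp_const _)
  have hT'var : Var[id; T'] = Var[id; expSumMeasure n β] := by
    rw [hT', variance_id_map (by fun_prop)]
    exact variance_add_const aestronglyMeasurable_id _
  have hmass : Q₀ Set.univ = k := by
    have h := congrArg (fun μ => μ Set.univ) hconv
    simp only [Measure.conv, Measure.smul_apply, measure_univ, smul_eq_mul, mul_one] at h
    rw [Measure.map_apply (by fun_prop) MeasurableSet.univ, Set.preimage_univ,
      ← Set.univ_prod_univ, Measure.prod_prod, measure_univ (μ := expMeasure β), mul_one,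
      Measure.map_apply hgm MeasurableSet.univ, Set.preimage_univ] at h
    exact h
  have hZ : ENNReal.ofReal (∫ y, paretoWeight n β a y) = k := by
    have hlint : ∫⁻ y, ENNReal.ofReal (paretoWeight n β a y) = k := by
      rw [← hmass, hQ₀, withDensity_apply _ MeasurableSet.univ, setLIntegral_univ]
    rw [integral_eq_lintegral_of_nonneg_ae (.of_forall (paretoWeight_nonneg ha))
      (by fun_prop), hlint, ENNReal.ofReal_toReal hk]
  set Z := ∫ y, paretoWeight n β a y with hZdef
  have hZ0 : 0 < Z := ENNReal.ofReal_pos.1 (hZ ▸ pos_iff_ne_zero.2 hk0)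
  set Q := volume.withDensity fun x => ENNReal.ofReal (paretoWeight n β a x / Z) with hQ
  have hQQ₀ : Q = k⁻¹ • Q₀ := by
    rw [hQ, hQ₀, ← withDensity_smul _ (by fun_prop)]
    congr 1
    ext x
    rw [ENNReal.ofReal_div_of_pos hZ0, hZ, Pi.smul_apply, smul_eq_mul, div_eq_mul_inv, mul_comm]
  have hQprob : IsProbabilityMeasure Q :=
    ⟨by rw [hQQ₀, Measure.smul_apply, hmass, smul_eq_mul, ENNReal.inv_mul_cancel hk0 hk]⟩
  have hPprob : IsProbabilityMeasure (Q.map g) := Measure.isProbabilityMeasure_map (by fun_prop)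
  have hW : Q.map g ∗ expMeasure β = T' := by
    rw [hQQ₀, Measure.map_smul, Measure.conv_smul_left, hconv, smul_smul,
      ENNReal.inv_mul_cancel hk0 hk, one_smul]
  have hP2 : MemLp id 2 (Q.map g) := by
    rwa [← memLp_id_conv_expMeasure_iff hβ0, hW]
  have hvar : Var[g; Q] = ∑ i ∈ Finset.Icc 1 n, ((β - (i : ℝ))⁻¹) ^ 2 := by
    have h := variance_id_conv_expMeasure hβ0 hP2
    rw [hW, hT'var, hTvar, sum_range_succ_inv_sub_sq, variance_id_map (by fun_prop)] at h
    linarith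
  have hae : (fun x => -log (paretoWeight n β a x / Z)) =ᵐ[Q] fun x => β * g x + log Z := by
    have hpos : ∀ᵐ x ∂Q, 0 < paretoWeight n β a x := by
      rw [hQ, ae_withDensity_iff (by fun_prop)]
      refine .of_forall fun x hx => ?_
      have h := ENNReal.ofReal_pos.1 (pos_iff_ne_zero.2 hx)
      exact (div_pos_iff_of_pos_right hZ0).1 h
    filter_upwards [hpos] with x hx
    rw [log_div hx.ne' hZ0.ne', hg]
    field_simp
    ring
  rw [variance_congr hae, variance_add_const (by fun_prop), variance_const_mul, hvar]

end Pareto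

/-- Let `β > n` and let `X` be a random vector in `ℝⁿ` with `(-1/β)`-concave
density `f`. Then the varentropy satisfies `Var(-log f(X)) ≤ β² ∑_{i=1}^n (β-i)⁻²`, and
equality holds for the Pareto distribution with density
`Z⁻¹ (a + x₁ + ⋯ + xₙ)^{-β}` on the positive orthant (for any `a > 0`). -/
theorem stmt12
    {Ω : Type*} [MeasureSpace Ω] [IsProbabilityMeasure (ℙ : Measure Ω)]
    (n : ℕ) (β : ℝ) (hβ : (n : ℝ) < β)
    (X : Ω → (Fin n → ℝ)) (hX : Measurable X)
    (f : (Fin n → ℝ) → ℝ) (hf_nonneg : ∀ x, 0 ≤ f x)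
    (hf_density : Measure.map X ℙ = volume.withDensity (fun x => ENNReal.ofReal (f x)))
    (hf_conv : ConvexOn ℝ {x | 0 < f x} (fun x => f x ^ (-1 / β))) :
    variance (fun ω => -Real.log (f (X ω))) ℙ
        ≤ β ^ 2 * ∑ i ∈ Finset.Icc 1 n, ((β - (i : ℝ))⁻¹) ^ 2 ∧
    ∀ a : ℝ, 0 < a →
      variance
        (fun x : Fin n → ℝ =>
          -Real.log (if ∀ i, 0 < x i then
              (a + ∑ i, x i) ^ (-β)
                / (∫ y in {y : Fin n → ℝ | ∀ i, 0 < y i}, (a + ∑ i, y i) ^ (-β))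
            else 0))
        (volume.withDensity (fun x : Fin n → ℝ => ENNReal.ofReal
          (if ∀ i, 0 < x i then
              (a + ∑ i, x i) ^ (-β)
                / (∫ y in {y : Fin n → ℝ | ∀ i, 0 < y i}, (a + ∑ i, y i) ^ (-β))
            else 0)))
      = β ^ 2 * ∑ i ∈ Finset.Icc 1 n, ((β - (i : ℝ))⁻¹) ^ 2 := by
  refine ⟨variance_neg_log_comp_le hβ hX hf_nonneg hf_density hf_conv, fun a ha => ?_⟩
  have h := variance_neg_log_pareto hβ ha
  have hZ : ∫ y, paretoWeight n β a y =
      ∫ y in {y : Fin n → ℝ | ∀ i, 0 < y i}, (a + ∑ i, y i) ^ (-β) := by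
    rw [← integral_indicator (measurableSet_orthant n)]
    congr 1
    ext y
    simp [paretoWeight, Set.indicator_apply]
  rw [hZ] at h
  simpa only [paretoWeight, ite_div, zero_div] using h
end
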